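/- arXiv:2008.09251 — 2 statements merged into one kernel-verified Lean document; each statement's English description precedes it below -/
import Mathlib

section
/- For the FPL algorithm run with parameter η = √((1+ln(SA))/(H²T)), the expected regret satisfies OPT − E[Σ_{t=1}^T V^{π_t}(r_t)] ≤ 2H²√((1+ln(SA))·T). -/
open MeasureTheory ProbabilityTheory

section MDP

variable {S A : Type} [Fintype S] [Fintype A]

/-- Validity of a transition kernel given as a function `S → A → S → ℝ`. -/
def IsKernel (p : S → A → S → ℝ) : Prop :=
  (∀ s a s', 0 ≤ p s a s') ∧ ∀ s a, ∑ s' : S, p s a s' = 1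

/-- `polVal p r π n h s` is the expected reward collected by the deterministic policy `π`
in the MDP with transition kernel `p` and reward `r`, over `n` steps starting at
state `s` in layer `h` (the layer increases by one at each step).  The value
`V^π_h(s, r)` of the paper is `polVal p r π (H + 1 - h) h s`, and
`V^π(r) = polVal p r π H 1 s₁`. -/
noncomputable def polVal (p : S → A → S → ℝ) (r : S → A → ℕ → ℝ) (π : S → ℕ → A) :
    ℕ → ℕ → S → ℝ
  | 0, _, _ => 0
  | n + 1, h, s =>
      r s (π s h) h + ∑ s' : S, p s (π s h) s' * polVal p r π n (h + 1) s'

/-- `optVal p r n h s` is the optimal value over `n` steps starting at state `s`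
in layer `h`, computed by backward value iteration. -/
noncomputable def optVal [Nonempty A] (p : S → A → S → ℝ) (r : S → A → ℕ → ℝ) :
    ℕ → ℕ → S → ℝ
  | 0, _, _ => 0
  | n + 1, h, s =>
      ⨆ a : A, (r s a h + ∑ s' : S, p s a s' * optVal p r n (h + 1) s')

/-- A policy is optimal for the reward `r` in the horizon-`H` MDP if it attains the optimal
value at every state and layer; this is exactly what backward value iteration produces. -/
def IsOptimal [Nonempty A] (p : S → A → S → ℝ) (r : S → A → ℕ → ℝ) (H : ℕ)
    (π : S → ℕ → A) : Prop :=
  ∀ h s, 1 ≤ h → h ≤ H → polVal p r π (H + 1 - h) h s = optVal p r (H + 1 - h) h s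

end MDP

section Helpers

set_option linter.all false

variable {S A : Type} [Fintype S] [Fintype A]

open Classical in
/-- indicator that `a` is a (weak) maximiser of `q` -/
noncomputable def wI (q : A → ℝ) (a : A) : ENNReal :=
  if ∀ a', q a' ≤ q a then 1 else 0

open Classical in
/-- indicator that `a` is the strict maximiser of `q` -/
noncomputable def sI (q : A → ℝ) (a : A) : ENNReal :=
  if ∀ a', a' ≠ a → q a' < q a then 1 else 0

noncomputable def bq (p : S → A → S → ℝ) (w : S × A → ℝ) (W : S → ℝ) (s : S) (a : A) : ℝ :=
  w (s, a) + ∑ s' : S, p s a s' * W s'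

noncomputable def bmax (p : S → A → S → ℝ) (w : S × A → ℝ) (W : S → ℝ) (s : S) : ℝ :=
  ⨆ a : A, bq p w W s a

def lay (R : S → A → ℕ → ℝ) (h : ℕ) : S × A → ℝ := fun x => R x.1 x.2 h

noncomputable def upV [Nonempty A] (p : S → A → S → ℝ) (R r : S → A → ℕ → ℝ) :
    ℕ → ℕ → S → ENNReal
  | 0, _, _ => 0
  | n + 1, h, s => ∑ a : A, wI (bq p (lay R h) (optVal p R n (h + 1)) s) a *
      (ENNReal.ofReal (r s a h) + ∑ s' : S, ENNReal.ofReal (p s a s') * upV p R r n (h + 1) s')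

noncomputable def loV [Nonempty A] (p : S → A → S → ℝ) (R r : S → A → ℕ → ℝ) :
    ℕ → ℕ → S → ENNReal
  | 0, _, _ => 0
  | n + 1, h, s => ∑ a : A, sI (bq p (lay R h) (optVal p R n (h + 1)) s) a *
      (ENNReal.ofReal (r s a h) + ∑ s' : S, ENNReal.ofReal (p s a s') * loV p R r n (h + 1) s')

lemma optVal_succ' [Nonempty A] (p : S → A → S → ℝ) (R : S → A → ℕ → ℝ) (n h : ℕ) :
    optVal p R (n + 1) h = bmax p (lay R h) (optVal p R n (h + 1)) := by
  funext s
  simp [optVal, bmax, bq, lay]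

lemma psum_le {p : S → A → S → ℝ} (hp : IsKernel p) {U V : S → ℝ} {c : ℝ}
    (h : ∀ s, U s ≤ V s + c) (s : S) (a : A) :
    ∑ s' : S, p s a s' * U s' ≤ ∑ s' : S, p s a s' * V s' + c := by
  have h1 : ∑ s' : S, p s a s' * V s' + c = ∑ s' : S, p s a s' * (V s' + c) := by
    simp only [mul_add, Finset.sum_add_distrib, ← Finset.sum_mul, hp.2 s a, one_mul]
  rw [h1]
  exact Finset.sum_le_sum fun s' _ => mul_le_mul_of_nonneg_left (h s') (hp.1 s a s')

lemma bq_le_bmax (p : S → A → S → ℝ) (w : S × A → ℝ) (W : S → ℝ) (s : S) (a : A) :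
    bq p w W s a ≤ bmax p w W s :=
  le_ciSup (f := fun a => bq p w W s a) (Set.finite_range _).bddAbove a

lemma bmax_le_add [Nonempty A] {p : S → A → S → ℝ} {w w' : S × A → ℝ} {W W' : S → ℝ} {s : S}
    {c : ℝ} (h : ∀ a, bq p w W s a ≤ bq p w' W' s a + c) :
    bmax p w W s ≤ bmax p w' W' s + c :=
  ciSup_le fun a => (h a).trans (by linarith [bq_le_bmax p w' W' s a])

lemma bq_le_add {p : S → A → S → ℝ} (hp : IsKernel p) {w w' : S × A → ℝ} {W W' : S → ℝ}
    {c d : ℝ} (hw : ∀ x, w x ≤ w' x + d) (hW : ∀ s, W s ≤ W' s + c) (s : S) (a : A) :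
    bq p w W s a ≤ bq p w' W' s a + (c + d) := by
  unfold bq
  have := psum_le hp hW s a
  have := hw (s, a)
  linarith

lemma optVal_mono [Nonempty A] {p : S → A → S → ℝ} (hp : IsKernel p) {R R' : S → A → ℕ → ℝ}
    (h : ∀ s a j, R s a j ≤ R' s a j) (n k : ℕ) (s : S) : optVal p R n k s ≤ optVal p R' n k s := by
  induction n generalizing k s with
  | zero => simp [optVal]
  | succ n ih =>
    rw [optVal_succ', optVal_succ']
    have := bmax_le_add (s := s) (c := 0 + 0) (fun a => bq_le_add hp (w := lay R k) (w' := lay R' k)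
      (fun x => by rw [add_zero]; exact h x.1 x.2 k)
      (fun s => by simpa using ih (k + 1) s) s a)
    linarith

lemma optVal_le_add [Nonempty A] {p : S → A → S → ℝ} (hp : IsKernel p) {R R' : S → A → ℕ → ℝ}
    (h : ∀ s a j, R' s a j ≤ R s a j + 1) (n k : ℕ) (s : S) :
    optVal p R' n k s ≤ optVal p R n k s + n := by
  induction n generalizing k s with
  | zero => simp [optVal]
  | succ n ih =>
    rw [optVal_succ', optVal_succ']
    push_cast
    exact bmax_le_add (s := s) (fun a => bq_le_add hp (w := lay R' k) (w' := lay R k)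
      (fun x => h x.1 x.2 k) (fun s => ih (k + 1) s) s a)

lemma optVal_congr [Nonempty A] {p : S → A → S → ℝ} {R R' : S → A → ℕ → ℝ} (n k : ℕ)
    (h : ∀ s a j, k ≤ j → j < k + n → R s a j = R' s a j) (s : S) :
    optVal p R n k s = optVal p R' n k s := by
  induction n generalizing k s with
  | zero => simp [optVal]
  | succ n ih =>
    simp only [optVal]
    have e : ∀ s', optVal p R n (k + 1) s' = optVal p R' n (k + 1) s' := fun s' =>
      ih (k + 1) (fun s a j h1 h2 => h s a j (by omega) (by omega)) s'
    simp only [e, h s _ k le_rfl (by omega)]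

lemma polVal_congr {p : S → A → S → ℝ} {R R' : S → A → ℕ → ℝ} {π : S → ℕ → A} (n k : ℕ)
    (h : ∀ s a j, k ≤ j → j < k + n → R s a j = R' s a j) (s : S) :
    polVal p R π n k s = polVal p R' π n k s := by
  induction n generalizing k s with
  | zero => simp [polVal]
  | succ n ih =>
    simp only [polVal]
    have e : ∀ s', polVal p R π n (k + 1) s' = polVal p R' π n (k + 1) s' := fun s' =>
      ih (k + 1) (fun s a j h1 h2 => h s a j (by omega) (by omega)) s'
    simp only [e, h s _ k le_rfl (by omega)]

lemma polVal_le_optVal [Nonempty A] {p : S → A → S → ℝ} (hp : IsKernel p) {R R' : S → A → ℕ → ℝ}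
    {π : S → ℕ → A} (n k : ℕ)
    (h : ∀ s a j, k ≤ j → j < k + n → R s a j ≤ R' s a j) (s : S) :
    polVal p R π n k s ≤ optVal p R' n k s := by
  induction n generalizing k s with
  | zero => simp [polVal, optVal]
  | succ n ih =>
    rw [optVal_succ']
    refine le_trans ?_ (bq_le_bmax _ _ _ _ (π s k))
    simp only [polVal, bq, lay]
    have := psum_le (c := 0) hp (U := polVal p R π n (k + 1)) (V := optVal p R' n (k + 1))
      (fun s' => by
        simpa using ih (k + 1) (fun s a j h1 h2 => h s a j (by omega) (by omega)) s') s (π s k)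
    have := h s (π s k) k le_rfl (by omega)
    linarith

lemma polVal_nonneg {p : S → A → S → ℝ} (hp : IsKernel p) {r : S → A → ℕ → ℝ}
    (hr : ∀ s a h, 0 ≤ r s a h) (π : S → ℕ → A) (n k : ℕ) (s : S) : 0 ≤ polVal p r π n k s := by
  induction n generalizing k s with
  | zero => simp [polVal]
  | succ n ih =>
    simp only [polVal]
    exact add_nonneg (hr _ _ _)
      (Finset.sum_nonneg fun s' _ => mul_nonneg (hp.1 _ _ _) (ih _ _))

lemma polVal_le {p : S → A → S → ℝ} (hp : IsKernel p) {r : S → A → ℕ → ℝ}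
    (hr : ∀ s a h, r s a h ≤ 1) (π : S → ℕ → A) (n k : ℕ) (s : S) : polVal p r π n k s ≤ n := by
  induction n generalizing k s with
  | zero => simp [polVal]
  | succ n ih =>
    simp only [polVal]
    have := psum_le hp (U := polVal p r π n (k + 1)) (V := fun _ => 0) (c := n)
      (fun s' => by simpa using ih (k + 1) s') s (π s k)
    have := hr s (π s k) k
    push_cast
    simp at *
    linarith

/-- bound of the optimal value by layerwise bounds of the reward -/
lemma optVal_le_sum [Nonempty A] {p : S → A → S → ℝ} (hp : IsKernel p) {R : S → A → ℕ → ℝ}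
    (M : ℕ → ℝ) (n k : ℕ) (h : ∀ s a j, k ≤ j → j < k + n → R s a j ≤ M j) (s : S) :
    optVal p R n k s ≤ ∑ j ∈ Finset.range n, M (k + j) := by
  induction n generalizing k s with
  | zero => simp [optVal]
  | succ n ih =>
    rw [optVal_succ']
    refine ciSup_le fun a => ?_
    simp only [bq, lay]
    have := psum_le hp (U := optVal p R n (k + 1)) (V := fun _ => 0)
      (c := ∑ j ∈ Finset.range n, M (k + 1 + j))
      (fun s' => by
        simpa using ih (k + 1) (fun s a j h1 h2 => h s a j (by omega) (by omega)) s') s a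
    have h2 := h s a k le_rfl (by omega)
    rw [Finset.sum_range_succ']
    simp only [mul_zero, Finset.sum_const_zero, zero_add] at this
    rw [add_zero]
    have e : ∀ j, k + (j + 1) = k + 1 + j := fun j => by omega
    have e2 : ∑ j ∈ Finset.range n, M (k + (j + 1)) = ∑ j ∈ Finset.range n, M (k + 1 + j) :=
      Finset.sum_congr rfl fun j _ => by rw [e j]
    rw [e2]
    linarith

lemma optVal_sub_le_upV [Nonempty A] {p : S → A → S → ℝ} (hp : IsKernel p)
    {R R' r : S → A → ℕ → ℝ} (hr : ∀ s a h, 0 ≤ r s a h)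
    (hR : ∀ s a j, R' s a j = R s a j + r s a j) (n k : ℕ) (s : S) :
    ENNReal.ofReal (optVal p R' n k s - optVal p R n k s) ≤ upV p R' r n k s := by
  induction n generalizing k s with
  | zero => simp [optVal]
  | succ n ih =>
    obtain ⟨a, ha⟩ := Finite.exists_max (bq p (lay R' k) (optVal p R' n (k + 1)) s)
    have h1 : optVal p R' (n + 1) k s = bq p (lay R' k) (optVal p R' n (k + 1)) s a := by
      rw [optVal_succ']
      exact le_antisymm (ciSup_le ha) (bq_le_bmax _ _ _ _ _)
    have h2 : bq p (lay R k) (optVal p R n (k + 1)) s a ≤ optVal p R (n + 1) k s := by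
      rw [optVal_succ']; exact bq_le_bmax _ _ _ _ _
    rw [upV]
    refine le_trans ?_ (Finset.single_le_sum (fun _ _ => zero_le) (Finset.mem_univ a))
    rw [wI, if_pos ha, one_mul]
    calc ENNReal.ofReal (optVal p R' (n + 1) k s - optVal p R (n + 1) k s)
        ≤ ENNReal.ofReal (r s a k + ∑ s', p s a s' *
            (optVal p R' n (k + 1) s' - optVal p R n (k + 1) s')) := by
          apply ENNReal.ofReal_le_ofReal
          rw [h1]
          simp only [bq, lay, hR] at h2 ⊢
          simp only [mul_sub, Finset.sum_sub_distrib]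
          linarith
      _ ≤ ENNReal.ofReal (r s a k) + ∑ s', ENNReal.ofReal (p s a s' *
            (optVal p R' n (k + 1) s' - optVal p R n (k + 1) s')) := by
          rw [← ENNReal.ofReal_sum_of_nonneg]
          · exact ENNReal.ofReal_add_le
          · intro s' _
            have := optVal_mono hp (R := R) (R' := R')
              (fun s a j => by rw [hR]; linarith [hr s a j]) n (k + 1) s'
            exact mul_nonneg (hp.1 _ _ _) (by linarith)
      _ ≤ _ := by
          gcongr with s' _
          rw [ENNReal.ofReal_mul (hp.1 _ _ _)]
          gcongr
          exact ih _ _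

lemma loV_le_polVal [Nonempty A] {p : S → A → S → ℝ} (hp : IsKernel p)
    {R r : S → A → ℕ → ℝ} (hr : ∀ s a h, 0 ≤ r s a h) {H : ℕ} {π : S → ℕ → A}
    (hπ : IsOptimal p R H π) (n k : ℕ) (hk : 1 ≤ k) (hn : k + n = H + 1) (s : S) :
    loV p R r n k s ≤ ENNReal.ofReal (polVal p r π n k s) := by
  induction n generalizing k s with
  | zero => simp [loV]
  | succ n ih =>
    have e1 : bq p (lay R k) (optVal p R n (k + 1)) s (π s k)
        = bmax p (lay R k) (optVal p R n (k + 1)) s := by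
      have h1 := hπ k s hk (by omega)
      rw [show H + 1 - k = n + 1 by omega, optVal_succ'] at h1
      rw [← h1]
      simp only [polVal, bq, lay]
      congr 1
      refine Finset.sum_congr rfl fun s' _ => ?_
      congr 1
      rcases Nat.eq_zero_or_pos n with h0 | h0
      · subst h0; simp [optVal, polVal]
      · have h2 := hπ (k + 1) s' (by omega) (by omega)
        rw [show H + 1 - (k + 1) = n by omega] at h2
        exact h2.symm
    have key : ∀ a, a ≠ π s k → sI (bq p (lay R k) (optVal p R n (k + 1)) s) a = 0 := by
      intro a ha
      rw [sI, if_neg]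
      intro hc
      have := hc (π s k) ha.symm
      rw [e1] at this
      exact absurd (bq_le_bmax p (lay R k) (optVal p R n (k + 1)) s a) (not_le.2 this)
    rw [loV, Finset.sum_eq_single (π s k) (fun a _ ha => by rw [key a ha, zero_mul])
      (fun h => absurd (Finset.mem_univ _) h)]
    have h1 : sI (bq p (lay R k) (optVal p R n (k + 1)) s) (π s k) ≤ 1 := by
      unfold sI; split_ifs <;> simp
    simp only [polVal]
    rw [ENNReal.ofReal_add (hr _ _ _) (Finset.sum_nonneg fun s' _ => mul_nonneg (hp.1 _ _ _)
      (polVal_nonneg hp hr _ _ _ _)), ENNReal.ofReal_sum_of_nonneg (fun s' _ => mul_nonneg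
      (hp.1 _ _ _) (polVal_nonneg hp hr _ _ _ _))]
    refine (mul_le_mul' h1 le_rfl).trans ?_
    rw [one_mul]
    gcongr with s' _
    rw [ENNReal.ofReal_mul (hp.1 _ _ _)]
    gcongr
    exact ih (k + 1) (by omega) (by omega) s'

lemma polVal_add {p : S → A → S → ℝ} (r r' : S → A → ℕ → ℝ) (π : S → ℕ → A) (n k : ℕ) (s : S) :
    polVal p (fun s a h => r s a h + r' s a h) π n k s
      = polVal p r π n k s + polVal p r' π n k s := by
  induction n generalizing k s with
  | zero => simp [polVal]
  | succ n ih =>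
    simp only [polVal, ih, mul_add, Finset.sum_add_distrib]
    ring

/-! ### exponential distribution -/

lemma exp_shift {η c : ℝ} (hη : 0 < η) (hc : 0 ≤ c) {g : ℝ → ENNReal} (hg : Measurable g) :
    ∫⁻ x, g (x + c) ∂(expMeasure η)
      ≤ ENNReal.ofReal (Real.exp (η * c)) * ∫⁻ x, g x ∂(expMeasure η) := by
  have hm : Measurable (gammaPDF 1 η) := (measurable_gammaPDFReal 1 η).ennreal_ofReal
  have hg' : Measurable fun x => g (x + c) := hg.comp (measurable_id.add_const c)
  unfold expMeasure gammaMeasure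
  rw [lintegral_withDensity_eq_lintegral_mul _ hm hg', lintegral_withDensity_eq_lintegral_mul _ hm hg,
    ← lintegral_add_right_eq_self (μ := volume) (fun x => (gammaPDF 1 η * g) x) c,
    ← lintegral_const_mul' _ _ ENNReal.ofReal_ne_top]
  refine lintegral_mono fun x => ?_
  simp only [Pi.mul_apply, ← mul_assoc]
  refine mul_le_mul' ?_ le_rfl
  change exponentialPDF η x ≤ _ * exponentialPDF η (x + c)
  by_cases hx : 0 ≤ x
  · rw [exponentialPDF_of_nonneg hx, exponentialPDF_of_nonneg (by linarith),
      ← ENNReal.ofReal_mul (Real.exp_pos _).le]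
    apply ENNReal.ofReal_le_ofReal
    rw [mul_left_comm, ← Real.exp_add]
    ring_nf
    exact le_rfl
  · rw [exponentialPDF_of_neg (by linarith)]; exact zero_le

lemma exp_tail {η y : ℝ} (hη : 0 < η) (hy : 0 ≤ y) :
    expMeasure η (Set.Ioi y) = ENNReal.ofReal (Real.exp (-(η * y))) := by
  have := isProbabilityMeasure_expMeasure hη
  rw [← Set.compl_Iic, prob_compl_eq_one_sub measurableSet_Iic, ← ofReal_cdf,
    cdf_expMeasure_eq hη, if_pos hy, ← ENNReal.ofReal_one, ← ENNReal.ofReal_sub _ (by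
      simp; positivity)]
  congr 1; ring

lemma exp_excess {η m : ℝ} (hη : 0 < η) (hm : 0 ≤ m) :
    ∫⁻ x, ENNReal.ofReal (max (x - m) 0) ∂(expMeasure η)
      ≤ ENNReal.ofReal (Real.exp (-(η * m)) / η) := by
  rw [lintegral_eq_lintegral_meas_lt (f := fun x => max (x - m) 0) _ (Filter.Eventually.of_forall fun x => le_max_right _ _)
    (by fun_prop)]
  calc ∫⁻ t in Set.Ioi 0, expMeasure η {x | t < max (x - m) 0}
      = ∫⁻ t in Set.Ioi 0, ENNReal.ofReal (Real.exp (-(η * m)) / η) * exponentialPDF η t := by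
        refine setLIntegral_congr_fun measurableSet_Ioi fun t ht => ?_
        have ht : 0 < t := ht
        have : {x | t < max (x - m) 0} = Set.Ioi (m + t) := by
          ext x; simp only [Set.mem_setOf_eq, lt_max_iff, Set.mem_Ioi]
          constructor
          · rintro (h | h) <;> linarith
          · intro h; left; linarith
        simp only [this]
        rw [exp_tail hη (by linarith), exponentialPDF_of_nonneg ht.le,
          ← ENNReal.ofReal_mul (by positivity)]
        congr 1
        rw [mul_add, neg_add, Real.exp_add]
        field_simp
    _ ≤ ∫⁻ t, ENNReal.ofReal (Real.exp (-(η * m)) / η) * exponentialPDF η t :=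
        setLIntegral_le_lintegral _ _
    _ = _ := by
        rw [lintegral_const_mul' _ _ ENNReal.ofReal_ne_top, lintegral_exponentialPDF_eq_one hη,
          mul_one]

lemma pi_shift {ι : Type} [Fintype ι] [DecidableEq ι] {η c : ℝ} (hη : 0 < η) (hc : 0 ≤ c) (i : ι)
    {g : (ι → ℝ) → ENNReal} (hg : Measurable g) :
    ∫⁻ x, g (Function.update x i (x i + c)) ∂(Measure.pi fun _ : ι => expMeasure η)
      ≤ ENNReal.ofReal (Real.exp (η * c)) * ∫⁻ x, g x ∂(Measure.pi fun _ : ι => expMeasure η) := by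
  have := isProbabilityMeasure_expMeasure hη
  have hu : Measurable fun x : ι → ℝ => Function.update x i (x i + c) := by
    refine measurable_pi_lambda _ fun j => ?_
    by_cases h : j = i
    · subst h; simp; fun_prop
    · simp [Function.update_of_ne h]; fun_prop
  rw [lintegral_eq_lmarginal_univ 0, lintegral_eq_lmarginal_univ 0,
    lmarginal_erase' (f := fun x => g (Function.update x i (x i + c))) (hg.comp hu) (Finset.mem_univ i), lmarginal_erase' (f := g) hg (Finset.mem_univ i)]
  simp only [Function.update_idem, Function.update_self]
  unfold lmarginal
  rw [← lintegral_const_mul' _ _ ENNReal.ofReal_ne_top]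
  refine lintegral_mono fun y => ?_
  exact exp_shift hη hc (hg.comp (measurable_update _))


/-! ### one layer -/

lemma layer_pointwise [Nonempty A] {p : S → A → S → ℝ} (hp : IsKernel p) [DecidableEq (S × A)]
    {β βp : S × A → ℝ} (hβ : ∀ x, β x ≤ βp x) (hβ' : ∀ x, βp x ≤ β x + 1)
    {δ ε C : ℝ} (hδ : 0 ≤ δ) (hε : 0 < ε) (hC : 0 ≤ C) {fp fm : (S → ℝ) → ENNReal}
    (hf : ∀ Wp Wm : S → ℝ, (∀ s, Wm s ≤ Wp s + (δ + ε)) → (∀ s, Wp s ≤ Wm s + (C + 1)) →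
      fp Wp ≤ fm Wm)
    {Wp Wm : S → ℝ} (h1 : ∀ s, Wm s ≤ Wp s + δ) (h2 : ∀ s, Wp s ≤ Wm s + C) (s : S) (a : A)
    (x : S × A → ℝ) (c : ℝ) (hc : c = bq p βp Wp s a - bq p β Wm s a + δ + ε) :
    fp (bmax p (βp + x) Wp) * wI (bq p (βp + x) Wp s) a ≤
      fm (bmax p (β + Function.update x (s, a) (x (s, a) + c)) Wm) *
        sI (bq p (β + Function.update x (s, a) (x (s, a) + c)) Wm s) a := by
  set x' := Function.update x (s, a) (x (s, a) + c) with hx'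
  have hA : ∀ s' a', bq p (β + x) Wm s' a' ≤ bq p (βp + x) Wp s' a' + (δ + 0) := fun s' a' =>
    bq_le_add hp (fun y => by simpa using hβ y) h1 s' a'
  have hB : ∀ s' a', bq p (βp + x) Wp s' a' ≤ bq p (β + x) Wm s' a' + (C + 1) := fun s' a' =>
    bq_le_add hp (fun y => by
      have := hβ' y
      simp only [Pi.add_apply]; linarith) h2 s' a'
  have hne : ∀ s' a', (s', a') ≠ (s, a) → bq p (β + x') Wm s' a' = bq p (β + x) Wm s' a' := by
    intro s' a' h
    simp [bq, hx', Function.update_of_ne h]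
  have heq : bq p (β + x') Wm s a = bq p (βp + x) Wp s a + (δ + ε) := by
    simp only [bq, hx', Pi.add_apply, Function.update_self]
    rw [hc]; simp only [bq]; ring
  have hup : ∀ s' a', bq p (β + x') Wm s' a' ≤ bq p (βp + x) Wp s' a' + (δ + ε) := by
    intro s' a'
    by_cases h : (s', a') = (s, a)
    · obtain ⟨rfl, rfl⟩ := Prod.mk.inj h
      exact heq.le
    · rw [hne s' a' h]; linarith [hA s' a']
  have hlo : ∀ s' a', bq p (βp + x) Wp s' a' ≤ bq p (β + x') Wm s' a' + (C + 1) := by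
    intro s' a'
    by_cases h : (s', a') = (s, a)
    · obtain ⟨rfl, rfl⟩ := Prod.mk.inj h
      rw [heq]; linarith
    · rw [hne s' a' h]; exact hB s' a'
  by_cases hw : ∀ a', bq p (βp + x) Wp s a' ≤ bq p (βp + x) Wp s a
  · have hs : ∀ a', a' ≠ a → bq p (β + x') Wm s a' < bq p (β + x') Wm s a := by
      intro a' ha'
      rw [heq, hne s a' (by simp [ha'])]
      linarith [hA s a', hw a']
    rw [wI, if_pos hw, sI, if_pos hs, mul_one, mul_one]
    exact hf _ _ (fun s' => bmax_le_add (hup s')) (fun s' => bmax_le_add (hlo s'))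
  · rw [wI, if_neg hw, mul_zero]; exact zero_le

lemma measurable_wI {α : Type} [MeasurableSpace α] {q : α → A → ℝ}
    (hq : ∀ a, Measurable fun x => q x a) (a : A) : Measurable fun x => wI (q x) a := by
  unfold wI
  refine Measurable.ite ?_ measurable_const measurable_const
  rw [Set.setOf_forall]
  exact MeasurableSet.iInter fun a' => measurableSet_le (hq a') (hq a)

lemma measurable_sI {α : Type} [MeasurableSpace α] {q : α → A → ℝ}
    (hq : ∀ a, Measurable fun x => q x a) (a : A) : Measurable fun x => sI (q x) a := by
  unfold sI
  refine Measurable.ite ?_ measurable_const measurable_const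
  simp only [Set.setOf_forall]
  exact MeasurableSet.iInter fun a' => MeasurableSet.iInter fun _ => measurableSet_lt (hq a') (hq a)

lemma measurable_bq {α : Type} [MeasurableSpace α] {p : S → A → S → ℝ} {w : α → S × A → ℝ}
    {W : α → S → ℝ} (hw : ∀ y, Measurable fun x => w x y) (hW : ∀ s, Measurable fun x => W x s)
    (s : S) (a : A) : Measurable fun x => bq p (w x) (W x) s a := by
  unfold bq
  exact (hw _).add (Finset.measurable_sum _ fun s' _ => (hW s').const_mul _)

lemma measurable_bmax {α : Type} [MeasurableSpace α] {p : S → A → S → ℝ} {w : α → S × A → ℝ}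
    {W : α → S → ℝ} (hw : ∀ y, Measurable fun x => w x y) (hW : ∀ s, Measurable fun x => W x s) :
    Measurable fun x => bmax p (w x) (W x) := by
  refine measurable_pi_lambda _ fun s => ?_
  unfold bmax
  exact Measurable.iSup fun a => measurable_bq hw hW s a

lemma measurable_optVal [Nonempty A] {α : Type} [MeasurableSpace α] (p : S → A → S → ℝ)
    (R : α → S → A → ℕ → ℝ) (n h : ℕ)
    (hR : ∀ s a j, h ≤ j → j < h + n → Measurable fun x => R x s a j) (s : S) :
    Measurable fun x => optVal p (R x) n h s := by
  induction n generalizing h s with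
  | zero => simp only [optVal]; exact measurable_const
  | succ n ih =>
    simp only [optVal_succ']
    exact (measurable_pi_apply s).comp (measurable_bmax
      (fun y => hR y.1 y.2 h le_rfl (by omega))
      (fun s => ih (h + 1) (fun s a j h1 h2 => hR s a j (by omega) (by omega)) s))

lemma measurable_upV [Nonempty A] {α : Type} [MeasurableSpace α] (p : S → A → S → ℝ)
    (R : α → S → A → ℕ → ℝ) (r : S → A → ℕ → ℝ) (n h : ℕ)
    (hR : ∀ s a j, h ≤ j → j < h + n → Measurable fun x => R x s a j) (s : S) :
    Measurable fun x => upV p (R x) r n h s := by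
  induction n generalizing h s with
  | zero => simp only [upV]; exact measurable_const
  | succ n ih =>
    simp only [upV]
    have hR' : ∀ s a j, h + 1 ≤ j → j < h + 1 + n → Measurable fun x => R x s a j :=
      fun s a j h1 h2 => hR s a j (by omega) (by omega)
    refine Finset.measurable_sum _ fun a _ => Measurable.mul ?_ (measurable_const.add
      (Finset.measurable_sum _ fun s' _ => (ih (h + 1) hR' s').const_mul _))
    exact measurable_wI (fun a => measurable_bq (fun y => hR y.1 y.2 h le_rfl (by omega))
      (fun s => measurable_optVal p R n (h + 1) hR' s) s a) a

lemma measurable_loV [Nonempty A] {α : Type} [MeasurableSpace α] (p : S → A → S → ℝ)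
    (R : α → S → A → ℕ → ℝ) (r : S → A → ℕ → ℝ) (n h : ℕ)
    (hR : ∀ s a j, h ≤ j → j < h + n → Measurable fun x => R x s a j) (s : S) :
    Measurable fun x => loV p (R x) r n h s := by
  induction n generalizing h s with
  | zero => simp only [loV]; exact measurable_const
  | succ n ih =>
    simp only [loV]
    have hR' : ∀ s a j, h + 1 ≤ j → j < h + 1 + n → Measurable fun x => R x s a j :=
      fun s a j h1 h2 => hR s a j (by omega) (by omega)
    refine Finset.measurable_sum _ fun a _ => Measurable.mul ?_ (measurable_const.add
      (Finset.measurable_sum _ fun s' _ => (ih (h + 1) hR' s').const_mul _))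
    exact measurable_sI (fun a => measurable_bq (fun y => hR y.1 y.2 h le_rfl (by omega))
      (fun s => measurable_optVal p R n (h + 1) hR' s) s a) a

/-- the integrand of one layer, weak version -/
noncomputable def gW (p : S → A → S → ℝ) (b : S × A → ℝ) (f : (S → ℝ) → ENNReal) (s : S) (a : A)
    (y : (S × A → ℝ) × (S → ℝ)) : ENNReal :=
  f (bmax p (b + y.1) y.2) * wI (bq p (b + y.1) y.2 s) a

/-- the integrand of one layer, strict version -/
noncomputable def gS (p : S → A → S → ℝ) (b : S × A → ℝ) (f : (S → ℝ) → ENNReal) (s : S) (a : A)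
    (y : (S × A → ℝ) × (S → ℝ)) : ENNReal :=
  f (bmax p (b + y.1) y.2) * sI (bq p (b + y.1) y.2 s) a

lemma measurable_gW (p : S → A → S → ℝ) (b : S × A → ℝ) {f : (S → ℝ) → ENNReal}
    (hf : Measurable f) (s : S) (a : A) : Measurable (gW p b f s a) := by
  have hw : ∀ y, Measurable fun x : (S × A → ℝ) × (S → ℝ) => (b + x.1) y := fun y => by
    simp only [Pi.add_apply]; fun_prop
  have hW : ∀ y, Measurable fun x : (S × A → ℝ) × (S → ℝ) => x.2 y := fun y => by fun_prop
  exact (hf.comp (measurable_bmax hw hW)).mul (measurable_wI (fun a => measurable_bq hw hW s a) a)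

lemma measurable_gS (p : S → A → S → ℝ) (b : S × A → ℝ) {f : (S → ℝ) → ENNReal}
    (hf : Measurable f) (s : S) (a : A) : Measurable (gS p b f s a) := by
  have hw : ∀ y, Measurable fun x : (S × A → ℝ) × (S → ℝ) => (b + x.1) y := fun y => by
    simp only [Pi.add_apply]; fun_prop
  have hW : ∀ y, Measurable fun x : (S × A → ℝ) × (S → ℝ) => x.2 y := fun y => by fun_prop
  exact (hf.comp (measurable_bmax hw hW)).mul (measurable_sI (fun a => measurable_bq hw hW s a) a)

lemma layer_int [Nonempty A] {p : S → A → S → ℝ} (hp : IsKernel p) {η : ℝ} (hη : 0 < η)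
    {β βp : S × A → ℝ} (hβ : ∀ x, β x ≤ βp x) (hβ' : ∀ x, βp x ≤ β x + 1)
    {δ ε C : ℝ} (hδ : 0 ≤ δ) (hε : 0 < ε) (hC : 0 ≤ C) {fp fm : (S → ℝ) → ENNReal}
    (hfm : Measurable fm)
    (hf : ∀ Wp Wm : S → ℝ, (∀ s, Wm s ≤ Wp s + (δ + ε)) → (∀ s, Wp s ≤ Wm s + (C + 1)) →
      fp Wp ≤ fm Wm)
    {Wp Wm : S → ℝ} (h1 : ∀ s, Wm s ≤ Wp s + δ) (h2 : ∀ s, Wp s ≤ Wm s + C) (s : S) (a : A) :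
    ∫⁻ x, gW p βp fp s a (x, Wp) ∂(Measure.pi fun _ : S × A => expMeasure η) ≤
      ENNReal.ofReal (Real.exp (η * (C + 1 + δ + ε))) *
        ∫⁻ x, gS p β fm s a (x, Wm) ∂(Measure.pi fun _ : S × A => expMeasure η) := by
  classical
  set c := bq p βp Wp s a - bq p β Wm s a + δ + ε with hc
  have hc0 : 0 ≤ c := by
    have := bq_le_add hp (d := 0) (fun y => by simpa using hβ y) h1 s a
    rw [hc]; linarith
  have hc1 : c ≤ C + 1 + δ + ε := by
    have := bq_le_add hp hβ' h2 s a
    rw [hc]; linarith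
  calc _ ≤ ∫⁻ x, gS p β fm s a (Function.update x (s, a) (x (s, a) + c), Wm)
          ∂(Measure.pi fun _ : S × A => expMeasure η) :=
        lintegral_mono fun x => layer_pointwise hp hβ hβ' hδ hε hC hf h1 h2 s a x c hc
    _ ≤ ENNReal.ofReal (Real.exp (η * c)) *
          ∫⁻ x, gS p β fm s a (x, Wm) ∂(Measure.pi fun _ : S × A => expMeasure η) :=
        pi_shift hη hc0 (s, a) (g := fun x => gS p β fm s a (x, Wm))
          ((measurable_gS p β hfm s a).comp (by fun_prop))
    _ ≤ _ := by gcongr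


/-! ### probabilistic part -/

lemma fub {Ω α β : Type} [MeasurableSpace Ω] [MeasurableSpace α] [MeasurableSpace β]
    {P : Measure Ω} [IsProbabilityMeasure P] {X : Ω → α} {V : Ω → β} {Y : Ω → ENNReal}
    (hX : Measurable X) (hV : Measurable V) (hY : Measurable Y)
    (hind : IndepFun X (fun ω => (V ω, Y ω)) P) {g : α × β → ENNReal} (hg : Measurable g) :
    ∫⁻ ω, g (X ω, V ω) * Y ω ∂P = ∫⁻ ω, (∫⁻ x, g (x, V ω) ∂(P.map X)) * Y ω ∂P := by
  have : IsProbabilityMeasure (P.map X) := Measure.isProbabilityMeasure_map hX.aemeasurable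
  have hVY : Measurable fun ω => (V ω, Y ω) := hV.prodMk hY
  have : IsProbabilityMeasure (P.map fun ω => (V ω, Y ω)) :=
    Measure.isProbabilityMeasure_map hVY.aemeasurable
  let G : α × (β × ENNReal) → ENNReal := fun y => g (y.1, y.2.1) * y.2.2
  have hG : Measurable G := by
    refine Measurable.mul (hg.comp ?_) ?_ <;> fun_prop
  have hmap := (indepFun_iff_map_prod_eq_prod_map_map hX.aemeasurable hVY.aemeasurable).1 hind
  calc ∫⁻ ω, g (X ω, V ω) * Y ω ∂P = ∫⁻ ω, G (X ω, (V ω, Y ω)) ∂P := rfl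
    _ = ∫⁻ y, G y ∂(P.map fun ω => (X ω, (V ω, Y ω))) := by
        rw [lintegral_map hG (hX.prodMk hVY)]
    _ = ∫⁻ w, ∫⁻ x, G (x, w) ∂(P.map X) ∂(P.map fun ω => (V ω, Y ω)) := by
        rw [hmap, lintegral_prod_symm _ hG.aemeasurable]
    _ = ∫⁻ ω, ∫⁻ x, G (x, (V ω, Y ω)) ∂(P.map X) ∂P := by
        rw [lintegral_map hG.lintegral_prod_left' hVY]
    _ = _ := by
        refine lintegral_congr fun ω => ?_
        exact lintegral_mul_const _ (hg.comp (by fun_prop))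

section prob

variable {Ω : Type} [mΩ : MeasurableSpace Ω] {P : Measure Ω} [IsProbabilityMeasure P] {H : ℕ}
  {z : Ω → S → A → ℕ → ℝ}

/-- sigma-algebra of the layers after `h` -/
def mT (z : Ω → S → A → ℕ → ℝ) (H h : ℕ) : MeasurableSpace Ω :=
  ⨆ i ∈ {i : S × A × Fin H | h < i.2.2.val + 1},
    MeasurableSpace.comap (fun ω => z ω i.1 i.2.1 (i.2.2.val + 1)) inferInstance

lemma mT_meas (s : S) (a : A) (h j : ℕ) (h1 : h + 1 ≤ j) (h2 : j ≤ H) :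
    Measurable[mT z H h] fun ω => z ω s a j := by
  have hle : MeasurableSpace.comap (fun ω => z ω s a j) inferInstance ≤ mT z H h := by
    have := le_biSup (f := fun i : S × A × Fin H =>
      MeasurableSpace.comap (fun ω => z ω i.1 i.2.1 (i.2.2.val + 1)) inferInstance)
      (s := {i : S × A × Fin H | h < i.2.2.val + 1}) (i := (s, a, ⟨j - 1, by omega⟩))
      (by simp; omega)
    simp only [show j - 1 + 1 = j by omega] at this
    exact this
  exact measurable_iff_comap_le.2 hle

lemma mT_indep (hz : ∀ s a h, Measurable fun ω => z ω s a h)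
    (hind : iIndepFun (fun (x : S × A × Fin H) ω => z ω x.1 x.2.1 (x.2.2.val + 1)) P)
    {h : ℕ} (h1 : 1 ≤ h) (h2 : h ≤ H) {β : Type} [MeasurableSpace β] {Y : Ω → β}
    (hY : Measurable[mT z H h] Y) : IndepFun (fun ω => lay (z ω) h) Y P := by
  have hI := indep_iSup_of_disjoint (fun i => (hz _ _ _).comap_le) hind.iIndep
    (S := {i : S × A × Fin H | i.2.2.val + 1 = h}) (T := {i : S × A × Fin H | h < i.2.2.val + 1})
    (by
      rw [Set.disjoint_left]; intro i hi hi'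
      simp only [Set.mem_setOf_eq] at hi hi'; omega)
  rw [IndepFun_iff_Indep]
  refine indep_of_indep_of_le_left (indep_of_indep_of_le_right hI hY.comap_le) ?_
  rw [← measurable_iff_comap_le]
  refine @measurable_pi_lambda _ _ _ (_) _ _ fun y => ?_
  rw [measurable_iff_comap_le]
  have := le_biSup (f := fun i : S × A × Fin H =>
      MeasurableSpace.comap (fun ω => z ω i.1 i.2.1 (i.2.2.val + 1)) inferInstance)
      (s := {i : S × A × Fin H | i.2.2.val + 1 = h}) (i := (y.1, y.2, ⟨h - 1, by omega⟩))
      (by simp; omega)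
  simp only [show h - 1 + 1 = h by omega] at this
  exact this

lemma mT_le (hz : ∀ s a h, Measurable fun ω => z ω s a h) (h : ℕ) : mT z H h ≤ mΩ :=
  iSup₂_le fun _ _ => (hz _ _ _).comap_le

lemma layer_law {η : ℝ} (hz : ∀ s a h, Measurable fun ω => z ω s a h)
    (hd : ∀ s a h, 1 ≤ h → h ≤ H → Measure.map (fun ω => z ω s a h) P = expMeasure η)
    (hind : iIndepFun (fun (x : S × A × Fin H) ω => z ω x.1 x.2.1 (x.2.2.val + 1)) P)
    {h : ℕ} (h1 : 1 ≤ h) (h2 : h ≤ H) :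
    P.map (fun ω => lay (z ω) h) = Measure.pi fun _ : S × A => expMeasure η := by
  have hi := hind.precomp (g := fun y : S × A => (y.1, y.2, (⟨h - 1, by omega⟩ : Fin H)))
    (by rintro ⟨a, b⟩ ⟨c, d⟩ h; simpa using h)
  rw [iIndepFun_iff_map_fun_eq_pi_map (fun i => (hz _ _ _).aemeasurable)] at hi
  simp only [show h - 1 + 1 = h by omega] at hi
  have e : (fun ω => lay (z ω) h) = fun ω (i : S × A) => z ω i.1 i.2 h := rfl
  rw [e, hi]
  congr 1
  funext i
  exact hd _ _ _ h1 h2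

lemma stab_ind [Nonempty A] {p : S → A → S → ℝ} (hp : IsKernel p) {η : ℝ} (hη : 0 < η)
    (hz : ∀ s a h, Measurable fun ω => z ω s a h)
    (hd : ∀ s a h, 1 ≤ h → h ≤ H → Measure.map (fun ω => z ω s a h) P = expMeasure η)
    (hind : iIndepFun (fun (x : S × A × Fin H) ω => z ω x.1 x.2.1 (x.2.2.val + 1)) P)
    {ρ ρ' r : S → A → ℕ → ℝ} (hr0 : ∀ s a h, 0 ≤ r s a h) (hr1 : ∀ s a h, r s a h ≤ 1)
    (hρ : ∀ s a h, ρ' s a h = ρ s a h + r s a h)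
    {ε : ℝ} (hε : 0 < ε) (n : ℕ) :
    ∀ h, 1 ≤ h → h + n = H + 1 → ∀ (s : S) (fp fm : (S → ℝ) → ENNReal), Measurable fp →
      Measurable fm →
      (∀ Wp Wm : S → ℝ, (∀ s, Wm s ≤ Wp s + n * ε) → (∀ s, Wp s ≤ Wm s + n) → fp Wp ≤ fm Wm) →
      ∫⁻ ω, fp (optVal p (fun s a h => z ω s a h + ρ' s a h) n h) *
          upV p (fun s a h => z ω s a h + ρ' s a h) r n h s ∂P ≤
        ENNReal.ofReal (Real.exp (η * (H * (1 + ε)))) ^ n *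
        ∫⁻ ω, fm (optVal p (fun s a h => z ω s a h + ρ s a h) n h) *
          loV p (fun s a h => z ω s a h + ρ s a h) r n h s ∂P := by
  set K : ENNReal := ENNReal.ofReal (Real.exp (η * (H * (1 + ε)))) with hK
  have hK1 : 1 ≤ K := by
    rw [hK, ← ENNReal.ofReal_one]
    exact ENNReal.ofReal_le_ofReal (Real.one_le_exp (by positivity))
  induction n with
  | zero => intro h _ _ s fp fm _ _ _; simp [upV]
  | succ n ih =>
    intro h h1 hn s fp fm hfp hfm hf
    set Rp : Ω → S → A → ℕ → ℝ := fun ω s a h => z ω s a h + ρ' s a h with hRp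
    set Rm : Ω → S → A → ℕ → ℝ := fun ω s a h => z ω s a h + ρ s a h with hRm
    have lp : ∀ ω, lay (Rp ω) h = lay ρ' h + lay (z ω) h := fun ω => by
      funext y; simp [lay, hRp, add_comm]
    have lm : ∀ ω, lay (Rm ω) h = lay ρ h + lay (z ω) h := fun ω => by
      funext y; simp [lay, hRm, add_comm]
    set Vp : Ω → S → ℝ := fun ω => optVal p (Rp ω) n (h + 1) with hVp
    set Vm : Ω → S → ℝ := fun ω => optVal p (Rm ω) n (h + 1) with hVm
    let ν : Measure (S × A → ℝ) := Measure.pi fun _ : S × A => expMeasure η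
    have : IsProbabilityMeasure (expMeasure η) := isProbabilityMeasure_expMeasure hη
    have hX : Measurable fun ω => lay (z ω) h := measurable_pi_lambda _ fun y => hz _ _ _
    have hlaw := layer_law hz hd hind h1 (by omega)
    -- measurability with respect to the later layers
    have mRp : ∀ s a j, h + 1 ≤ j → j < h + 1 + n → Measurable[mT z H h] fun ω => Rp ω s a j :=
      fun s a j g1 g2 => (mT_meas (z := z) (H := H) s a h j g1 (by omega)).add_const _
    have mRm : ∀ s a j, h + 1 ≤ j → j < h + 1 + n → Measurable[mT z H h] fun ω => Rm ω s a j :=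
      fun s a j g1 g2 => (mT_meas (z := z) (H := H) s a h j g1 (by omega)).add_const _
    have mVp : Measurable[mT z H h] Vp := @measurable_pi_lambda _ _ _ (mT z H h) _ _ fun s =>
      @measurable_optVal _ _ _ _ _ _ (mT z H h) p Rp n (h + 1) mRp s
    have mVm : Measurable[mT z H h] Vm := @measurable_pi_lambda _ _ _ (mT z H h) _ _ fun s =>
      @measurable_optVal _ _ _ _ _ _ (mT z H h) p Rm n (h + 1) mRm s
    have mUp : ∀ s, Measurable[mT z H h] fun ω => upV p (Rp ω) r n (h + 1) s := fun s =>
      @measurable_upV _ _ _ _ _ _ (mT z H h) p Rp r n (h + 1) mRp s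
    have mLo : ∀ s, Measurable[mT z H h] fun ω => loV p (Rm ω) r n (h + 1) s := fun s =>
      @measurable_loV _ _ _ _ _ _ (mT z H h) p Rm r n (h + 1) mRm s
    have mle : mT z H h ≤ mΩ := mT_le hz h
    -- the integrated functions
    let f2p : A → (S → ℝ) → ENNReal := fun a W => ∫⁻ x, gW p (lay ρ' h) fp s a (x, W) ∂ν
    let f2m : A → (S → ℝ) → ENNReal := fun a W => K * ∫⁻ x, gS p (lay ρ h) fm s a (x, W) ∂ν
    have hf2p : ∀ a, Measurable (f2p a) := fun a =>
      (measurable_gW p (lay ρ' h) hfp s a).lintegral_prod_left'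
    have hf2m : ∀ a, Measurable (f2m a) := fun a =>
      (measurable_gS p (lay ρ h) hfm s a).lintegral_prod_left'.const_mul _
    have hf2 : ∀ a, ∀ Wp Wm : S → ℝ, (∀ s, Wm s ≤ Wp s + n * ε) → (∀ s, Wp s ≤ Wm s + n) →
        f2p a Wp ≤ f2m a Wm := by
      intro a Wp Wm g1 g2
      have hl := layer_int hp hη (β := lay ρ h) (βp := lay ρ' h)
        (fun y => by simp only [lay, hρ]; linarith [hr0 y.1 y.2 h])
        (fun y => by simp only [lay, hρ]; linarith [hr1 y.1 y.2 h])
        (δ := n * ε) (ε := ε) (C := n) (by positivity) hε (by positivity) hfm (fp := fp)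
        (fun Wp Wm k1 k2 => hf Wp Wm
          (fun s => (k1 s).trans (by push_cast; linarith))
          (fun s => (k2 s).trans (by push_cast; linarith))) g1 g2 s a
      refine hl.trans (mul_le_mul' ?_ le_rfl)
      refine ENNReal.ofReal_le_ofReal (Real.exp_le_exp.2 ?_)
      have : ((n : ℝ) + 1) ≤ H := by exact_mod_cast (by omega : n + 1 ≤ H)
      have e : (n : ℝ) + 1 + n * ε + ε = (n + 1) * (1 + ε) := by ring
      rw [e]
      gcongr
    -- Fubini
    have fubp : ∀ a (Y : Ω → ENNReal), Measurable[mT z H h] Y →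
        ∫⁻ ω, gW p (lay ρ' h) fp s a (lay (z ω) h, Vp ω) * Y ω ∂P = ∫⁻ ω, f2p a (Vp ω) * Y ω ∂P := by
      intro a Y hY
      have := fub hX (mVp.mono mle le_rfl) (hY.mono mle le_rfl)
        (mT_indep hz hind h1 (by omega) (mVp.prodMk hY)) (measurable_gW p (lay ρ' h) hfp s a)
      rw [this, hlaw]
    have fubm : ∀ a (Y : Ω → ENNReal), Measurable[mT z H h] Y →
        K * ∫⁻ ω, gS p (lay ρ h) fm s a (lay (z ω) h, Vm ω) * Y ω ∂P
          = ∫⁻ ω, f2m a (Vm ω) * Y ω ∂P := by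
      intro a Y hY
      have := fub hX (mVm.mono mle le_rfl) (hY.mono mle le_rfl)
        (mT_indep hz hind h1 (by omega) (mVm.prodMk hY)) (measurable_gS p (lay ρ h) hfm s a)
      rw [this, hlaw, ← lintegral_const_mul' _ _ ENNReal.ofReal_ne_top]
      simp only [f2m, mul_assoc, ν]
      rfl
    -- expansion
    have mgp : ∀ a, Measurable fun ω => gW p (lay ρ' h) fp s a (lay (z ω) h, Vp ω) := fun a =>
      (measurable_gW p (lay ρ' h) hfp s a).comp (hX.prodMk (mVp.mono mle le_rfl))
    have mgm : ∀ a, Measurable fun ω => gS p (lay ρ h) fm s a (lay (z ω) h, Vm ω) := fun a =>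
      (measurable_gS p (lay ρ h) hfm s a).comp (hX.prodMk (mVm.mono mle le_rfl))
    have expp : ∫⁻ ω, fp (optVal p (Rp ω) (n + 1) h) * upV p (Rp ω) r (n + 1) h s ∂P
        = ∑ a, (ENNReal.ofReal (r s a h) *
            ∫⁻ ω, gW p (lay ρ' h) fp s a (lay (z ω) h, Vp ω) * 1 ∂P + ∑ s', ENNReal.ofReal (p s a s') *
            ∫⁻ ω, gW p (lay ρ' h) fp s a (lay (z ω) h, Vp ω) * upV p (Rp ω) r n (h + 1) s' ∂P) := by
      have e : ∀ ω, fp (optVal p (Rp ω) (n + 1) h) * upV p (Rp ω) r (n + 1) h s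
          = ∑ a, (ENNReal.ofReal (r s a h) *
            (gW p (lay ρ' h) fp s a (lay (z ω) h, Vp ω) * 1) + ∑ s', ENNReal.ofReal (p s a s') *
            (gW p (lay ρ' h) fp s a (lay (z ω) h, Vp ω) * upV p (Rp ω) r n (h + 1) s')) := by
        intro ω
        rw [upV, optVal_succ', lp, Finset.mul_sum]
        refine Finset.sum_congr rfl fun a _ => ?_
        simp only [gW, hVp]
        rw [← mul_assoc, mul_add, Finset.mul_sum]
        congr 1
        · ring
        · exact Finset.sum_congr rfl fun s' _ => by ring
      rw [lintegral_congr e, lintegral_finsetSum _ (fun a _ => by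
        exact (((mgp a).mul_const 1).const_mul _).add (Finset.measurable_sum _ fun s' _ =>
          ((mgp a).mul ((mUp s').mono mle le_rfl)).const_mul _))]
      refine Finset.sum_congr rfl fun a _ => ?_
      rw [lintegral_add_left (((mgp a).mul_const 1).const_mul _),
        lintegral_const_mul' _ _ ENNReal.ofReal_ne_top, lintegral_finsetSum _ (fun s' _ => by
          exact ((mgp a).mul ((mUp s').mono mle le_rfl)).const_mul _)]
      congr 1
      exact Finset.sum_congr rfl fun s' _ => lintegral_const_mul' _ _ ENNReal.ofReal_ne_top
    have expm : ∫⁻ ω, fm (optVal p (Rm ω) (n + 1) h) * loV p (Rm ω) r (n + 1) h s ∂P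
        = ∑ a, (ENNReal.ofReal (r s a h) *
            ∫⁻ ω, gS p (lay ρ h) fm s a (lay (z ω) h, Vm ω) * 1 ∂P + ∑ s', ENNReal.ofReal (p s a s') *
            ∫⁻ ω, gS p (lay ρ h) fm s a (lay (z ω) h, Vm ω) * loV p (Rm ω) r n (h + 1) s' ∂P) := by
      have e : ∀ ω, fm (optVal p (Rm ω) (n + 1) h) * loV p (Rm ω) r (n + 1) h s
          = ∑ a, (ENNReal.ofReal (r s a h) *
            (gS p (lay ρ h) fm s a (lay (z ω) h, Vm ω) * 1) + ∑ s', ENNReal.ofReal (p s a s') *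
            (gS p (lay ρ h) fm s a (lay (z ω) h, Vm ω) * loV p (Rm ω) r n (h + 1) s')) := by
        intro ω
        rw [loV, optVal_succ', lm, Finset.mul_sum]
        refine Finset.sum_congr rfl fun a _ => ?_
        simp only [gS, hVm]
        rw [← mul_assoc, mul_add, Finset.mul_sum]
        congr 1
        · ring
        · exact Finset.sum_congr rfl fun s' _ => by ring
      rw [lintegral_congr e, lintegral_finsetSum _ (fun a _ => by
        exact (((mgm a).mul_const 1).const_mul _).add (Finset.measurable_sum _ fun s' _ =>
          ((mgm a).mul ((mLo s').mono mle le_rfl)).const_mul _))]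
      refine Finset.sum_congr rfl fun a _ => ?_
      rw [lintegral_add_left (((mgm a).mul_const 1).const_mul _),
        lintegral_const_mul' _ _ ENNReal.ofReal_ne_top, lintegral_finsetSum _ (fun s' _ => by
          exact ((mgm a).mul ((mLo s').mono mle le_rfl)).const_mul _)]
      congr 1
      exact Finset.sum_congr rfl fun s' _ => lintegral_const_mul' _ _ ENNReal.ofReal_ne_top
    rw [expp, expm, Finset.mul_sum]
    refine Finset.sum_le_sum fun a _ => ?_
    rw [mul_add, Finset.mul_sum]
    refine add_le_add ?_ (Finset.sum_le_sum fun s' _ => ?_)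
    · rw [fubp a (fun _ => 1) (@measurable_const _ _ _ (mT z H h) _), mul_left_comm]
      refine mul_le_mul' le_rfl ?_
      rw [pow_succ, mul_assoc, fubm a (fun _ => 1) (@measurable_const _ _ _ (mT z H h) _)]
      calc ∫⁻ ω, f2p a (Vp ω) * 1 ∂P ≤ ∫⁻ ω, f2m a (Vm ω) * 1 ∂P := by
            refine lintegral_mono fun ω => mul_le_mul' (hf2 a _ _ (fun s => ?_) (fun s => ?_)) le_rfl
            · have := optVal_mono hp (R := Rm ω) (R' := Rp ω) (fun s a j => by
                simp only [hRm, hRp, hρ]; linarith [hr0 s a j]) n (h + 1) s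
              have : 0 ≤ n * ε := by positivity
              simp only [hVp, hVm]; linarith
            · exact optVal_le_add hp (R := Rm ω) (R' := Rp ω) (fun s a j => by
                simp only [hRm, hRp, hρ]; linarith [hr1 s a j]) n (h + 1) s
        _ ≤ _ := le_mul_of_one_le_left zero_le (one_le_pow₀ hK1)
    · rw [fubp a _ (mUp s'), mul_left_comm]
      refine mul_le_mul' le_rfl ?_
      rw [pow_succ, mul_assoc, fubm a _ (mLo s')]
      exact ih (h + 1) (by omega) (by omega) s' (f2p a) (f2m a) (hf2p a) (hf2m a) (hf2 a)

end prob


section final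

variable {Ω : Type} [mΩ : MeasurableSpace Ω] {P : Measure Ω} [IsProbabilityMeasure P] {H : ℕ}
  {z : Ω → S → A → ℕ → ℝ}

lemma int_bdd {f : Ω → ℝ} (hf : Measurable f) {C : ℝ} (h0 : ∀ ω, 0 ≤ f ω) (h1 : ∀ ω, f ω ≤ C) :
    Integrable f P := by
  refine Integrable.of_bound hf.aestronglyMeasurable C (Filter.Eventually.of_forall fun ω => ?_)
  rw [Real.norm_eq_abs, abs_of_nonneg (h0 ω)]
  exact h1 ω

lemma stab [Nonempty A] {p : S → A → S → ℝ} (hp : IsKernel p) {η : ℝ} (hη : 0 < η)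
    (hz : ∀ s a h, Measurable fun ω => z ω s a h)
    (hd : ∀ s a h, 1 ≤ h → h ≤ H → Measure.map (fun ω => z ω s a h) P = expMeasure η)
    (hind : iIndepFun (fun (x : S × A × Fin H) ω => z ω x.1 x.2.1 (x.2.2.val + 1)) P)
    {ρ ρ' r : S → A → ℕ → ℝ} (hr0 : ∀ s a h, 0 ≤ r s a h) (hr1 : ∀ s a h, r s a h ≤ 1)
    (hρ : ∀ s a h, ρ' s a h = ρ s a h + r s a h) (s : S)
    {π : Ω → S → ℕ → A}
    (hπ : ∀ᵐ ω ∂P, IsOptimal p (fun s a h => z ω s a h + ρ s a h) H (π ω))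
    (hm : Measurable fun ω => polVal p r (π ω) H 1 s) :
    Integrable (fun ω => optVal p (fun s a h => z ω s a h + ρ' s a h) H 1 s
        - optVal p (fun s a h => z ω s a h + ρ s a h) H 1 s) P ∧
    ∫ ω, (optVal p (fun s a h => z ω s a h + ρ' s a h) H 1 s
        - optVal p (fun s a h => z ω s a h + ρ s a h) H 1 s) ∂P
      ≤ ∫ ω, polVal p r (π ω) H 1 s ∂P + η * H ^ 3 := by
  set D : Ω → ℝ := fun ω => optVal p (fun s a h => z ω s a h + ρ' s a h) H 1 s
        - optVal p (fun s a h => z ω s a h + ρ s a h) H 1 s with hD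
  set v : Ω → ℝ := fun ω => polVal p r (π ω) H 1 s with hv
  have D0 : ∀ ω, 0 ≤ D ω := fun ω => sub_nonneg.2 <|
    optVal_mono hp (fun s a j => by rw [hρ]; linarith [hr0 s a j]) H 1 s
  have D1 : ∀ ω, D ω ≤ H := fun ω => by
    have := optVal_le_add hp (R := fun s a h => z ω s a h + ρ s a h)
      (R' := fun s a h => z ω s a h + ρ' s a h)
      (fun s a j => by rw [hρ]; linarith [hr1 s a j]) H 1 s
    simp only [hD]; linarith
  have v0 : ∀ ω, 0 ≤ v ω := fun ω => polVal_nonneg hp hr0 _ _ _ _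
  have v1 : ∀ ω, v ω ≤ H := fun ω => polVal_le hp hr1 _ _ _ _
  have mD : Measurable D :=
    (measurable_optVal p (fun ω s a h => z ω s a h + ρ' s a h) H 1
      (fun s a j _ _ => (hz s a j).add_const _) s).sub
    (measurable_optVal p (fun ω s a h => z ω s a h + ρ s a h) H 1
      (fun s a j _ _ => (hz s a j).add_const _) s)
  have iD : Integrable D P := int_bdd mD D0 D1
  have iv : Integrable v P := int_bdd hm v0 v1
  have iD0 : 0 ≤ ∫ ω, D ω ∂P := integral_nonneg D0
  have iv0 : 0 ≤ ∫ ω, v ω ∂P := integral_nonneg v0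
  have iD1 : ∫ ω, D ω ∂P ≤ H := by
    have := integral_mono iD (integrable_const (H : ℝ)) D1
    simpa using this
  refine ⟨iD, ?_⟩
  have key : ∀ ε : ℝ, 0 < ε → ∫ ω, D ω ∂P ≤ Real.exp (H * (η * (H * (1 + ε)))) * ∫ ω, v ω ∂P := by
    intro ε hε
    have h1 := stab_ind hp hη hz hd hind hr0 hr1 hρ hε H 1 le_rfl (by omega) s
      (fun _ => 1) (fun _ => 1) measurable_const measurable_const (fun _ _ _ _ => le_rfl)
    simp only [one_mul] at h1
    have h2 : ∫⁻ ω, ENNReal.ofReal (D ω) ∂P ≤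
        ENNReal.ofReal (Real.exp (η * (H * (1 + ε)))) ^ H * ∫⁻ ω, ENNReal.ofReal (v ω) ∂P := by
      refine le_trans (lintegral_mono fun ω => ?_) (h1.trans (mul_le_mul' le_rfl ?_))
      · exact optVal_sub_le_upV hp hr0 (fun s a j => by rw [hρ, add_assoc]) H 1 s
      · refine lintegral_mono_ae ?_
        filter_upwards [hπ] with ω hω
        exact loV_le_polVal hp hr0 hω H 1 le_rfl (by omega) s
    rw [← ofReal_integral_eq_lintegral_ofReal iD (Filter.Eventually.of_forall D0),
      ← ofReal_integral_eq_lintegral_ofReal iv (Filter.Eventually.of_forall v0),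
      ← ENNReal.ofReal_pow (Real.exp_pos _).le, ← ENNReal.ofReal_mul (by positivity),
      ENNReal.ofReal_le_ofReal_iff (by positivity), ← Real.exp_nat_mul] at h2
    exact h2
  have key2 : ∫ ω, D ω ∂P ≤ Real.exp (H * (η * (H * (1 + 0)))) * ∫ ω, v ω ∂P := by
    have hc : Filter.Tendsto (fun ε : ℝ => Real.exp (H * (η * (H * (1 + ε)))) * ∫ ω, v ω ∂P)
        (nhdsWithin 0 (Set.Ioi 0)) (nhds (Real.exp (H * (η * (H * (1 + 0)))) * ∫ ω, v ω ∂P)) := by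
      have : Continuous (fun ε : ℝ => Real.exp (H * (η * (H * (1 + ε)))) * ∫ ω, v ω ∂P) := by
        fun_prop
      exact (this.tendsto 0).mono_left nhdsWithin_le_nhds
    refine ge_of_tendsto hc ?_
    filter_upwards [self_mem_nhdsWithin] with ε hε
    exact key ε hε
  set x : ℝ := H * (η * (H * (1 + 0))) with hx
  have hx2 : x = η * H ^ 2 := by rw [hx]; ring
  have e1 : Real.exp (-x) * ∫ ω, D ω ∂P ≤ ∫ ω, v ω ∂P := by
    calc Real.exp (-x) * ∫ ω, D ω ∂P ≤ Real.exp (-x) * (Real.exp x * ∫ ω, v ω ∂P) := by gcongr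
      _ = _ := by rw [← mul_assoc, ← Real.exp_add]; simp
  have e2 : 1 - x ≤ Real.exp (-x) := by linarith [Real.add_one_le_exp (-x)]
  have e3 : (1 - x) * ∫ ω, D ω ∂P ≤ Real.exp (-x) * ∫ ω, D ω ∂P := by gcongr
  have e4 : x * ∫ ω, D ω ∂P ≤ x * H := by
    have : 0 ≤ x := by rw [hx2]; positivity
    gcongr
  have e5 : x * H = η * H ^ 3 := by rw [hx2]; ring
  linarith

lemma noise {η m : ℝ} (hη : 0 < η) (hm : 0 ≤ m)
    (hz : ∀ s a h, Measurable fun ω => z ω s a h)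
    (hd : ∀ s a h, 1 ≤ h → h ≤ H → Measure.map (fun ω => z ω s a h) P = expMeasure η)
    (s : S) (a : A) (h : ℕ) (h1 : 1 ≤ h) (h2 : h ≤ H) :
    Integrable (fun ω => max (z ω s a h - m) 0) P ∧
      ∫ ω, max (z ω s a h - m) 0 ∂P ≤ Real.exp (-(η * m)) / η := by
  have hmm : Measurable (fun ω => max (z ω s a h - m) 0) := ((hz s a h).sub_const m).max measurable_const
  have hle : ∫⁻ ω, ENNReal.ofReal (max (z ω s a h - m) 0) ∂P ≤ ENNReal.ofReal (Real.exp (-(η * m)) / η) := by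
    refine le_trans (le_of_eq ?_) (exp_excess hη hm)
    rw [← hd s a h h1 h2, lintegral_map (by fun_prop) (hz s a h)]
  have hi : Integrable (fun ω => max (z ω s a h - m) 0) P := by
    refine ⟨hmm.aestronglyMeasurable, ?_⟩
    refine (hasFiniteIntegral_iff_ofReal (f := fun ω => max (z ω s a h - m) 0)
      (Filter.Eventually.of_forall fun _ => le_max_right _ _)).2 ?_
    exact hle.trans_lt ENNReal.ofReal_lt_top
  refine ⟨hi, ?_⟩
  rw [← ofReal_integral_eq_lintegral_ofReal hi (Filter.Eventually.of_forall fun _ => le_max_right _ _),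
    ENNReal.ofReal_le_ofReal_iff (by positivity)] at hle
  exact hle

lemma core [Nonempty S] [Nonempty A] {p : S → A → S → ℝ} (hp : IsKernel p) {η : ℝ} (hη : 0 < η)
    (hz : ∀ s a h, Measurable fun ω => z ω s a h)
    (hd : ∀ s a h, 1 ≤ h → h ≤ H → Measure.map (fun ω => z ω s a h) P = expMeasure η)
    (hind : iIndepFun (fun (x : S × A × Fin H) ω => z ω x.1 x.2.1 (x.2.2.val + 1)) P)
    (T : ℕ) (s₁ : S)
    (r : ℕ → S → A → ℕ → ℝ) (hr : ∀ t s a h, 0 ≤ r t s a h ∧ r t s a h ≤ 1)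
    (π : ℕ → Ω → S → ℕ → A)
    (hπopt : ∀ t, ∀ᵐ ω ∂P, IsOptimal p
      (fun s a h => z ω s a h + ∑ τ ∈ Finset.Icc 1 (t - 1), r τ s a h) H (π t ω))
    (hπmeas : ∀ t, Measurable fun ω => polVal p (r t) (π t ω) H 1 s₁) (πstar : S → ℕ → A) :
    polVal p (fun s a h => ∑ τ ∈ Finset.Icc 1 T, r τ s a h) πstar H 1 s₁
      ≤ ∑ t ∈ Finset.Icc 1 T, (∫ ω, polVal p (r t) (π t ω) H 1 s₁ ∂P + η * H ^ 3)
        + H * ((1 + Real.log (Fintype.card S * Fintype.card A)) / η) := by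
  set N : ℝ := Fintype.card S * Fintype.card A with hN
  have hN1 : 1 ≤ N := by
    rw [hN]; exact_mod_cast Nat.mul_pos Fintype.card_pos Fintype.card_pos
  set m : ℝ := Real.log N / η with hm
  have hm0 : 0 ≤ m := div_nonneg (Real.log_nonneg hN1) hη.le
  have hem : Real.exp (-(η * m)) = N⁻¹ := by
    rw [hm, mul_div_cancel₀ _ hη.ne', Real.exp_neg, Real.exp_log (by linarith)]
  let O : ℕ → Ω → ℝ := fun t ω =>
    optVal p (fun s a h => z ω s a h + ∑ τ ∈ Finset.Icc 1 t, r τ s a h) H 1 s₁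
  let M : Ω → ℕ → ℝ := fun ω h => m + ∑ y : S × A, max (z ω y.1 y.2 h - m) 0
  have hst : ∀ t ∈ Finset.Icc 1 T, Integrable (fun ω => O t ω - O (t - 1) ω) P ∧
      ∫ ω, (O t ω - O (t - 1) ω) ∂P ≤ ∫ ω, polVal p (r t) (π t ω) H 1 s₁ ∂P + η * H ^ 3 := by
    intro t ht
    obtain ⟨k, rfl⟩ : ∃ k, t = k + 1 := ⟨t - 1, by have := (Finset.mem_Icc.1 ht).1; omega⟩
    exact stab hp hη hz hd hind (fun s a h => (hr (k + 1) s a h).1) (fun s a h => (hr (k + 1) s a h).2)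
      (fun s a h => Finset.sum_Icc_succ_top (by omega) _) s₁ (hπopt (k + 1)) (hπmeas (k + 1))
  have htel : ∀ ω, ∑ t ∈ Finset.Icc 1 T, (O t ω - O (t - 1) ω) = O T ω - O 0 ω := by
    intro ω
    clear hst
    induction T with
    | zero => simp
    | succ k ih => rw [Finset.sum_Icc_succ_top (by omega), ih]; simp
  have hz0 : ∀ᵐ ω ∂P, ∀ s a, ∀ h : ℕ, 1 ≤ h → h ≤ H → 0 ≤ z ω s a h := by
    rw [ae_all_iff]; intro s
    rw [ae_all_iff]; intro a
    rw [ae_all_iff]; intro h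
    by_cases hh : 1 ≤ h ∧ h ≤ H
    · have h0 : ∀ᵐ x ∂(expMeasure η), (0:ℝ) < x := by
        have := isProbabilityMeasure_expMeasure hη
        have h1 := exp_tail hη (le_refl (0:ℝ))
        simp only [mul_zero, neg_zero, Real.exp_zero, ENNReal.ofReal_one] at h1
        exact (prob_compl_eq_zero_iff measurableSet_Ioi).2 h1
      rw [← hd s a h hh.1 hh.2] at h0
      filter_upwards [ae_of_ae_map (hz s a h).aemeasurable h0] with ω hω _ _
      exact hω.le
    · exact Filter.Eventually.of_forall fun ω g1 g2 => absurd ⟨g1, g2⟩ hh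
  have hpt : ∀ᵐ ω ∂P, polVal p (fun s a h => ∑ τ ∈ Finset.Icc 1 T, r τ s a h) πstar H 1 s₁
      ≤ ∑ t ∈ Finset.Icc 1 T, (O t ω - O (t - 1) ω) + ∑ j ∈ Finset.range H, M ω (1 + j) := by
    filter_upwards [hz0] with ω hω
    rw [htel]
    have h1 : polVal p (fun s a h => ∑ τ ∈ Finset.Icc 1 T, r τ s a h) πstar H 1 s₁ ≤ O T ω :=
      polVal_le_optVal hp H 1 (fun s a j g1 g2 => by
        have := hω s a j g1 (by omega); linarith) s₁
    have h2 : O 0 ω ≤ ∑ j ∈ Finset.range H, M ω (1 + j) := by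
      refine optVal_le_sum hp (M ω) H 1 (fun s a j g1 g2 => ?_) s₁
      have h3 : max (z ω s a j - m) 0 ≤ ∑ y : S × A, max (z ω y.1 y.2 j - m) 0 :=
        Finset.single_le_sum (f := fun y : S × A => max (z ω y.1 y.2 j - m) 0)
          (fun y _ => le_max_right _ _) (Finset.mem_univ (s, a))
      have h4 := le_max_left (z ω s a j - m) 0
      simp only [M]
      simp
      linarith
    linarith
  have hM : ∀ j ∈ Finset.range H, Integrable (fun ω => M ω (1 + j)) P ∧
      ∫ ω, M ω (1 + j) ∂P ≤ (1 + Real.log N) / η := by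
    intro j hj
    have hj := Finset.mem_range.1 hj
    have hn := fun y : S × A => noise hη hm0 hz hd y.1 y.2 (1 + j) (by omega) (by omega)
    have i1 : Integrable (fun ω => ∑ y : S × A, max (z ω y.1 y.2 (1 + j) - m) 0) P :=
      integrable_finset_sum _ fun y _ => (hn y).1
    refine ⟨(integrable_const m).add i1, ?_⟩
    simp only [M]
    rw [integral_add (integrable_const m) i1, integral_finset_sum _ fun y _ => (hn y).1]
    have : ∑ y : S × A, ∫ ω, max (z ω y.1 y.2 (1 + j) - m) 0 ∂P ≤ ∑ y : S × A, N⁻¹ / η :=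
      Finset.sum_le_sum fun y _ => by rw [← hem]; exact (hn y).2
    have e : ∑ y : S × A, N⁻¹ / η = 1 / η := by
      rw [Finset.sum_const, Finset.card_univ, Fintype.card_prod, nsmul_eq_mul]
      push_cast
      rw [← hN]
      have : N ≠ 0 := by linarith
      field_simp
    rw [e] at this
    simp only [integral_const, probReal_univ, one_smul]
    rw [add_div]
    linarith
  have iS : Integrable (fun ω => ∑ t ∈ Finset.Icc 1 T, (O t ω - O (t - 1) ω)) P :=
    integrable_finset_sum _ fun t ht => (hst t ht).1
  have iM : Integrable (fun ω => ∑ j ∈ Finset.range H, M ω (1 + j)) P :=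
    integrable_finset_sum _ fun t ht => (hM t ht).1
  have hfin := integral_mono_ae (integrable_const _) (iS.add iM) hpt
  simp only [Pi.add_apply] at hfin
  rw [integral_add iS iM, integral_finset_sum _ fun t ht => (hst t ht).1,
    integral_finset_sum _ fun t ht => (hM t ht).1] at hfin
  simp only [integral_const, probReal_univ, one_smul] at hfin
  refine hfin.trans (add_le_add (Finset.sum_le_sum fun t ht => (hst t ht).2) ?_)
  refine (Finset.sum_le_sum fun t ht => (hM t ht).2).trans ?_
  simp

end final

end Helpers

/-- For the FPL algorithm run with parameter
`η = √((1 + ln(SA)) / (H² T))`, the expected regret satisfies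
`OPT − E[Σ_{t=1}^T V^{π_t}(r_t)] ≤ 2 H² √((1 + ln(SA)) T)`. -/
theorem fpl_known_transition_regret
    {S A : Type} [Fintype S] [Fintype A] [Nonempty S] [Nonempty A]
    {Ω : Type} [MeasurableSpace Ω] (P : Measure Ω) [IsProbabilityMeasure P]
    (H T : ℕ) (hH : 0 < H) (hT : 0 < T) (s₁ : S)
    -- the transition kernel, known to the learner
    (p : S → A → S → ℝ) (hp : IsKernel p)
    -- the FPL parameter
    (η : ℝ)
    (hη : η = Real.sqrt ((1 + Real.log (Fintype.card S * Fintype.card A)) / (H ^ 2 * T)))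
    -- the adversarially chosen rewards, with values in [0,1]
    (r : ℕ → S → A → ℕ → ℝ) (hr : ∀ t s a h, 0 ≤ r t s a h ∧ r t s a h ≤ 1)
    -- the random perturbation: i.i.d. Exp(η) entries over (s, a, h) with 1 ≤ h ≤ H
    (R0 : Ω → S → A → ℕ → ℝ)
    (hR0dist : ∀ s a h, 1 ≤ h → h ≤ H →
      Measure.map (fun ω => R0 ω s a h) P = expMeasure η)
    (hR0indep : iIndepFun
      (fun (x : S × A × Fin H) ω => R0 ω x.1 x.2.1 (x.2.2.val + 1)) P)
    -- in episode t, the algorithm plays an optimal policy for r_{0:t-1}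
    (π : ℕ → Ω → S → ℕ → A)
    (hπopt : ∀ t ω, IsOptimal p
      (fun s a h => R0 ω s a h + ∑ τ ∈ Finset.Icc 1 (t - 1), r τ s a h) H (π t ω))
    (hπmeas : ∀ t, Measurable fun ω => polVal p (r t) (π t ω) H 1 s₁) :
    -- regret bound, for every comparator policy (hence for the best policy in hindsight)
    ∀ πstar : S → ℕ → A,
      polVal p (fun s a h => ∑ τ ∈ Finset.Icc 1 T, r τ s a h) πstar H 1 s₁
          - ∫ ω, ∑ t ∈ Finset.Icc 1 T, polVal p (r t) (π t ω) H 1 s₁ ∂P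
        ≤ 2 * H ^ 2 *
            Real.sqrt ((1 + Real.log (Fintype.card S * Fintype.card A)) * T) := by
  intro πstar
  classical
  set L : ℝ := 1 + Real.log (Fintype.card S * Fintype.card A) with hL
  have hL1 : 1 ≤ L := by
    have hN1 : (1 : ℝ) ≤ Fintype.card S * Fintype.card A := by
      exact_mod_cast Nat.mul_pos Fintype.card_pos Fintype.card_pos
    have := Real.log_nonneg hN1
    rw [hL]; linarith
  have hHr : (0 : ℝ) < H := by exact_mod_cast hH
  have hTr : (0 : ℝ) < T := by exact_mod_cast hT
  have hη0 : 0 < η := by rw [hη]; apply Real.sqrt_pos.2; positivity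
  have hprob : IsProbabilityMeasure (expMeasure η) := isProbabilityMeasure_expMeasure hη0
  -- a measurable version of the perturbation
  have hae : ∀ s a h, 1 ≤ h → h ≤ H → AEMeasurable (fun ω => R0 ω s a h) P := by
    intro s a h h1 h2
    by_contra hc
    have := hR0dist s a h h1 h2
    rw [Measure.map_of_not_aemeasurable hc] at this
    exact IsProbabilityMeasure.ne_zero (expMeasure η) this.symm
  let z : Ω → S → A → ℕ → ℝ := fun ω s a h =>
    if hh : 1 ≤ h ∧ h ≤ H then (hae s a h hh.1 hh.2).mk _ ω else 0
  have hz : ∀ s a h, Measurable fun ω => z ω s a h := by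
    intro s a h
    by_cases hh : 1 ≤ h ∧ h ≤ H
    · simp only [z, dif_pos hh]; exact (hae s a h hh.1 hh.2).measurable_mk
    · simp only [z, dif_neg hh]; exact measurable_const
  have hzR : ∀ s a h, 1 ≤ h → h ≤ H → (fun ω => R0 ω s a h) =ᵐ[P] fun ω => z ω s a h := by
    intro s a h h1 h2
    have hh : 1 ≤ h ∧ h ≤ H := ⟨h1, h2⟩
    simp only [z, dif_pos hh]
    exact (hae s a h hh.1 hh.2).ae_eq_mk
  have hd : ∀ s a h, 1 ≤ h → h ≤ H → Measure.map (fun ω => z ω s a h) P = expMeasure η := by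
    intro s a h h1 h2
    rw [← Measure.map_congr (hzR s a h h1 h2), hR0dist s a h h1 h2]
  have hind : iIndepFun (fun (x : S × A × Fin H) ω => z ω x.1 x.2.1 (x.2.2.val + 1)) P :=
    hR0indep.congr fun x => hzR _ _ _ (by omega) (by omega)
  have hall : ∀ᵐ ω ∂P, ∀ s a, ∀ h : ℕ, 1 ≤ h → h ≤ H → R0 ω s a h = z ω s a h := by
    rw [ae_all_iff]; intro s
    rw [ae_all_iff]; intro a
    rw [ae_all_iff]; intro h
    by_cases hh : 1 ≤ h ∧ h ≤ H
    · filter_upwards [hzR s a h hh.1 hh.2] with ω hω _ _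
      exact hω
    · exact Filter.Eventually.of_forall fun ω g1 g2 => absurd ⟨g1, g2⟩ hh
  have hopt : ∀ t, ∀ᵐ ω ∂P, IsOptimal p
      (fun s a h => z ω s a h + ∑ τ ∈ Finset.Icc 1 (t - 1), r τ s a h) H (π t ω) := by
    intro t
    filter_upwards [hall] with ω hω h s h1 h2
    have hc : ∀ s a j, h ≤ j → j < h + (H + 1 - h) →
        z ω s a j + ∑ τ ∈ Finset.Icc 1 (t - 1), r τ s a j
          = R0 ω s a j + ∑ τ ∈ Finset.Icc 1 (t - 1), r τ s a j := fun s a j g1 g2 => by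
      rw [hω s a j (by omega) (by omega)]
    rw [polVal_congr (H + 1 - h) h hc s, optVal_congr (H + 1 - h) h hc s]
    exact hπopt t ω h s h1 h2
  have hcore := core hp hη0 hz hd hind T s₁ r hr π hopt hπmeas πstar
  rw [integral_finset_sum _ fun t _ => int_bdd (hπmeas t)
    (fun ω => polVal_nonneg hp (fun s a h => (hr t s a h).1) _ _ _ _)
    (fun ω => polVal_le hp (fun s a h => (hr t s a h).2) _ _ _ _)]
  rw [Finset.sum_add_distrib, Finset.sum_const, Nat.card_Icc, nsmul_eq_mul, ← hL] at hcore
  simp only [Nat.add_sub_cancel] at hcore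
  set w : ℝ := Real.sqrt (L * T) with hw
  have hw0 : 0 < w := Real.sqrt_pos.2 (by positivity)
  have hw2 : w * w = L * T := Real.mul_self_sqrt (by positivity)
  have hηw : η = w / (H * T) := by
    rw [hη, hw]
    rw [show L / ((H : ℝ) ^ 2 * T) = L * T / (H * T) ^ 2 by field_simp,
      Real.sqrt_div (by positivity), Real.sqrt_sq (by positivity)]
  have e1 : (T : ℝ) * (η * H ^ 3) = H ^ 2 * w := by rw [hηw]; field_simp
  have e2 : H * (L / η) = H ^ 2 * w := by
    rw [hηw]; field_simp; linarith
  rw [e1, e2] at hcore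
  linarith
end

section
/- Under the FPL algorithm with any parameter η > 0, for every episode t ∈ {1,…,T} and every state s, E[V^{π_{t+1}}(s, r_t)] ≤ e^{η H²} · E[V^{π_t}(s, r_t)], where V^π(s, r) = V^π_1(s, r) and the expectation is over the random perturbation r_0. -/
open MeasureTheory ProbabilityTheory

section FPLaux

open scoped ENNReal Classical

variable {S A : Type} [Fintype S] [Fintype A]

/-- State-action value under optimal continuation. -/
noncomputable def fplQ [Nonempty A] (p : S → A → S → ℝ) (ρ : S → A → ℕ → ℝ)
    (n h : ℕ) (s : S) (a : A) : ℝ :=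
  ρ s a h + ∑ s' : S, p s a s' * optVal p ρ n (h + 1) s'

lemma fpl_optVal_succ [Nonempty A] (p : S → A → S → ℝ) (ρ : S → A → ℕ → ℝ)
    (n h : ℕ) (s : S) : optVal p ρ (n + 1) h s = ⨆ a, fplQ p ρ n h s a := rfl

lemma fpl_bdd (f : A → ℝ) : BddAbove (Set.range f) := (Set.finite_range f).bddAbove

lemma fpl_optVal_congr [Nonempty A] (p : S → A → S → ℝ) (ρ ρ' : S → A → ℕ → ℝ)
    (n h : ℕ) (s : S) (hh : ∀ s a j, h ≤ j → j < h + n → ρ s a j = ρ' s a j) :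
    optVal p ρ n h s = optVal p ρ' n h s := by
  induction n generalizing h s with
  | zero => rfl
  | succ n ih =>
    rw [optVal, optVal]
    congr 1
    funext a
    rw [hh s a h le_rfl (by omega)]
    congr 1
    refine Finset.sum_congr rfl fun s' _ => ?_
    rw [ih (h + 1) s' fun s a j h1 h2 => hh s a j (by omega) (by omega)]

lemma fplQ_congr [Nonempty A] (p : S → A → S → ℝ) (ρ ρ' : S → A → ℕ → ℝ)
    (n h : ℕ) (s : S) (a : A) (hh : ∀ s a j, h ≤ j → j < h + n + 1 → ρ s a j = ρ' s a j) :
    fplQ p ρ n h s a = fplQ p ρ' n h s a := by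
  rw [fplQ, fplQ, hh s a h le_rfl (by omega)]
  congr 1
  refine Finset.sum_congr rfl fun s' _ => ?_
  rw [fpl_optVal_congr p ρ ρ' n (h + 1) s' fun s a j h1 h2 => hh s a j (by omega) (by omega)]

/-- Optimal value of the bumped reward (explicit recursion). -/
noncomputable def fplU [Nonempty A] (p : S → A → S → ℝ) (ρ q : S → A → ℕ → ℝ)
    (σ : ℕ → S) (α : ℕ → A) (k : ℕ) (ε : ℝ) : ℕ → ℕ → S → ℝ
  | 0, _, _ => 0
  | n + 1, h, s => ⨆ a : A, (ρ s a h
      + (if h < k ∧ s = σ h ∧ a = α h then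
          q (σ h) (α h) h + ∑ s' : S, p (σ h) (α h) s' *
            (optVal p (fun s a h => ρ s a h + q s a h) n (h + 1) s'
              - fplU p ρ q σ α k ε n (h + 1) s') + (n + 1) * ε else 0)
      + ∑ s' : S, p s a s' * fplU p ρ q σ α k ε n (h + 1) s')

noncomputable def fplB [Nonempty A] (p : S → A → S → ℝ) (ρ q : S → A → ℕ → ℝ)
    (σ : ℕ → S) (α : ℕ → A) (k : ℕ) (ε : ℝ) (n h : ℕ) : ℝ :=
  if h < k then
    q (σ h) (α h) h + ∑ s' : S, p (σ h) (α h) s' *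
            (optVal p (fun s a h => ρ s a h + q s a h) n (h + 1) s'
              - fplU p ρ q σ α k ε n (h + 1) s') + (n + 1) * ε else 0

lemma fplU_succ [Nonempty A] (p : S → A → S → ℝ) (ρ q : S → A → ℕ → ℝ)
    (σ : ℕ → S) (α : ℕ → A) (k : ℕ) (ε : ℝ) (n h : ℕ) (s : S) :
    fplU p ρ q σ α k ε (n + 1) h s = ⨆ a : A, (ρ s a h
      + (if s = σ h ∧ a = α h then fplB p ρ q σ α k ε n h else 0)
      + ∑ s' : S, p s a s' * fplU p ρ q σ α k ε n (h + 1) s') := by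
  rw [fplU]
  congr 1
  funext a
  unfold fplB
  by_cases h1 : h < k <;> simp [h1]

lemma fpl_avg (p : S → A → S → ℝ) (hp : IsKernel p) (s : S) (a : A) (f g : S → ℝ) (c : ℝ)
    (hfg : ∀ s, f s ≤ g s + c) :
    ∑ s', p s a s' * f s' ≤ ∑ s', p s a s' * g s' + c := by
  have h1 : ∑ s', p s a s' * f s' ≤ ∑ s', p s a s' * (g s' + c) :=
    Finset.sum_le_sum fun s' _ => mul_le_mul_of_nonneg_left (hfg s') (hp.1 s a s')
  simp only [mul_add, Finset.sum_add_distrib, ← Finset.sum_mul, hp.2 s a, one_mul] at h1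
  exact h1

/-- the key bound on the difference between the bumped and the shifted value -/
lemma fplU_bounds [Nonempty A] (p : S → A → S → ℝ) (hp : IsKernel p) (ρ q : S → A → ℕ → ℝ)
    (hq : ∀ s a h, 0 ≤ q s a h ∧ q s a h ≤ 1)
    (σ : ℕ → S) (α : ℕ → A) (k : ℕ) (ε : ℝ) (hε : 0 < ε) (n h : ℕ) (s : S) :
    fplU p ρ q σ α k ε n h s ≤ optVal p (fun s a h => ρ s a h + q s a h) n h s + n * ε ∧
    optVal p (fun s a h => ρ s a h + q s a h) n h s ≤ fplU p ρ q σ α k ε n h s + n := by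
  induction n generalizing h s with
  | zero => simp [fplU, optVal]
  | succ n ih =>
    have key1 : ∀ a, ∑ s', p s a s' * fplU p ρ q σ α k ε n (h + 1) s' ≤
        ∑ s', p s a s' * optVal p (fun s a h => ρ s a h + q s a h) n (h + 1) s' + n * ε :=
      fun a => fpl_avg p hp s a _ _ _ fun s' => (ih (h + 1) s').1
    have key2 : ∀ a, ∑ s', p s a s' * optVal p (fun s a h => ρ s a h + q s a h) n (h + 1) s' ≤
        ∑ s', p s a s' * fplU p ρ q σ α k ε n (h + 1) s' + n :=
      fun a => fpl_avg p hp s a _ _ _ fun s' => (ih (h + 1) s').2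
    rw [fplU_succ, fpl_optVal_succ]
    unfold fplB
    push_cast
    constructor
    · refine ciSup_le fun a => ?_
      have h3 := le_ciSup (fpl_bdd (fplQ p (fun s a h => ρ s a h + q s a h) n h s)) a
      refine le_trans ?_ (add_le_add_left h3 _)
      have := key1 a
      have := hq s a h
      unfold fplQ
      split_ifs with h1 h2
      · obtain ⟨rfl, rfl⟩ := h1
        simp only [mul_sub, Finset.sum_sub_distrib]
        linarith
      · linarith
      · linarith
    · refine ciSup_le fun a => ?_
      have h3 := le_ciSup (fpl_bdd (fun a => ρ s a h
      + (if s = σ h ∧ a = α h then (if h < k then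
    q (σ h) (α h) h + ∑ s' : S, p (σ h) (α h) s' *
            (optVal p (fun s a h => ρ s a h + q s a h) n (h + 1) s'
              - fplU p ρ q σ α k ε n (h + 1) s') + (n + 1) * ε else 0) else 0)
      + ∑ s' : S, p s a s' * fplU p ρ q σ α k ε n (h + 1) s')) a
      refine le_trans ?_ (add_le_add_left h3 _)
      have := key2 a
      have := hq s a h
      have hn : (0 : ℝ) ≤ n := Nat.cast_nonneg n
      have hne : 0 ≤ (n : ℝ) * ε := by positivity
      unfold fplQ
      dsimp only
      split_ifs with h1 h2
      · obtain ⟨rfl, rfl⟩ := h1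
        simp only [mul_sub, Finset.sum_sub_distrib]
        linarith
      · linarith
      · linarith

lemma fplB_bounds [Nonempty A] (p : S → A → S → ℝ) (hp : IsKernel p) (ρ q : S → A → ℕ → ℝ)
    (hq : ∀ s a h, 0 ≤ q s a h ∧ q s a h ≤ 1)
    (σ : ℕ → S) (α : ℕ → A) (k : ℕ) (ε : ℝ) (hε : 0 < ε) (n h : ℕ) :
    0 ≤ fplB p ρ q σ α k ε n h ∧ fplB p ρ q σ α k ε n h ≤ (n + 1) * (1 + ε) := by
  have key1 := fpl_avg p hp (σ h) (α h) _ _ _ fun s' =>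
    (fplU_bounds p hp ρ q hq σ α k ε hε n (h + 1) s').1
  have key2 := fpl_avg p hp (σ h) (α h) _ _ _ fun s' =>
    (fplU_bounds p hp ρ q hq σ α k ε hε n (h + 1) s').2
  have := hq (σ h) (α h) h
  unfold fplB
  split_ifs with h1
  · simp only [mul_sub, Finset.sum_sub_distrib]
    constructor <;> linarith
  · exact ⟨le_rfl, by positivity⟩

lemma fplU_congr [Nonempty A] (p : S → A → S → ℝ) (ρ ρ' q : S → A → ℕ → ℝ)
    (σ : ℕ → S) (α : ℕ → A) (k : ℕ) (ε : ℝ) (n h : ℕ) (s : S)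
    (hh : ∀ s a j, h ≤ j → ρ s a j = ρ' s a j) :
    fplU p ρ q σ α k ε n h s = fplU p ρ' q σ α k ε n h s := by
  induction n generalizing h s with
  | zero => rfl
  | succ n ih =>
    have e1 : ∀ s', fplU p ρ q σ α k ε n (h + 1) s' = fplU p ρ' q σ α k ε n (h + 1) s' :=
      fun s' => ih (h + 1) s' fun s a j h1 => hh s a j (by omega)
    have e2 : ∀ s', optVal p (fun s a h => ρ s a h + q s a h) n (h + 1) s' =
        optVal p (fun s a h => ρ' s a h + q s a h) n (h + 1) s' := fun s' =>
      fpl_optVal_congr _ _ _ _ _ _ fun s a j h1 _ => by simp only [hh s a j (by omega)]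
    rw [fplU, fplU]
    simp only [e1, e2, hh s _ h le_rfl]

lemma fplB_congr [Nonempty A] (p : S → A → S → ℝ) (ρ ρ' q : S → A → ℕ → ℝ)
    (σ : ℕ → S) (α : ℕ → A) (k : ℕ) (ε : ℝ) (n h : ℕ)
    (hh : ∀ s a j, h < j → ρ s a j = ρ' s a j) :
    fplB p ρ q σ α k ε n h = fplB p ρ' q σ α k ε n h := by
  have e1 : ∀ s', fplU p ρ q σ α k ε n (h + 1) s' = fplU p ρ' q σ α k ε n (h + 1) s' :=
    fun s' => fplU_congr _ _ _ _ _ _ _ _ _ _ _ fun s a j h1 => hh s a j (by omega)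
  have e2 : ∀ s', optVal p (fun s a h => ρ s a h + q s a h) n (h + 1) s' =
      optVal p (fun s a h => ρ' s a h + q s a h) n (h + 1) s' := fun s' =>
    fpl_optVal_congr _ _ _ _ _ _ fun s a j h1 _ => by simp only [hh s a j (by omega)]
  unfold fplB
  simp only [e1, e2]

/-- `fplU` is the optimal value of the bumped reward. -/
lemma fplU_eq [Nonempty A] (p : S → A → S → ℝ) (ρ ρ' q : S → A → ℕ → ℝ)
    (σ : ℕ → S) (α : ℕ → A) (k : ℕ) (ε : ℝ) (H : ℕ)
    (hρ' : ∀ s a h, 1 ≤ h → h ≤ H → ρ' s a h = ρ s a h +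
      if s = σ h ∧ a = α h then fplB p ρ q σ α k ε (H - h) h else 0)
    (n h : ℕ) (h1 : 1 ≤ h) (hn : h + n = H + 1) (s : S) :
    optVal p ρ' n h s = fplU p ρ q σ α k ε n h s := by
  induction n generalizing h s with
  | zero => rfl
  | succ n ih =>
    rw [fplU_succ, optVal]
    simp only [ih (h + 1) (by omega) (by omega), hρ' s _ h h1 (by omega)]
    rw [show H - h = n by omega]

/-- Weak optimality for the shifted reward gives strict optimality for the bumped reward. -/
lemma fpl_strict [Nonempty A] (p : S → A → S → ℝ) (hp : IsKernel p) (ρ ρ' q : S → A → ℕ → ℝ)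
    (hq : ∀ s a h, 0 ≤ q s a h ∧ q s a h ≤ 1)
    (σ : ℕ → S) (α : ℕ → A) (k : ℕ) (ε : ℝ) (hε : 0 < ε) (H : ℕ)
    (hρ' : ∀ s a h, 1 ≤ h → h ≤ H → ρ' s a h = ρ s a h +
      if s = σ h ∧ a = α h then fplB p ρ q σ α k ε (H - h) h else 0)
    (h : ℕ) (h1 : 1 ≤ h) (hH : h ≤ H) (hk : h < k)
    (hw : ∀ b, fplQ p (fun s a h => ρ s a h + q s a h) (H - h) h (σ h) b ≤
      fplQ p (fun s a h => ρ s a h + q s a h) (H - h) h (σ h) (α h)) :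
    ∀ b, b ≠ α h → fplQ p ρ' (H - h) h (σ h) b < fplQ p ρ' (H - h) h (σ h) (α h) := by
  intro b hb
  have hw := hw b
  have key1 := fpl_avg p hp (σ h) b _ _ _ fun s' =>
    (fplU_bounds p hp ρ q hq σ α k ε hε (H - h) (h + 1) s').1
  have := hq (σ h) b h
  unfold fplQ at hw ⊢
  simp only [fplU_eq p ρ ρ' q σ α k ε H hρ' (H - h) (h + 1) (by omega) (by omega),
    hρ' _ _ h h1 hH]
  simp only [hb, and_false, if_false, and_self, if_true, fplB, hk, mul_sub,
    Finset.sum_sub_distrib]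
  linarith

/-- one-dimensional shift -/
lemma fpl_shift (η : ℝ) (hη : 0 < η) (b : ℝ) (hb : 0 ≤ b) (f : ℝ → ℝ≥0∞) (hf : Measurable f) :
    ∫⁻ y, f (y + b) ∂(expMeasure η) ≤
      ENNReal.ofReal (Real.exp (η * b)) * ∫⁻ y, f y ∂(expMeasure η) := by
  have hm : Measurable (exponentialPDF η) := (measurable_exponentialPDFReal η).ennreal_ofReal
  have he : expMeasure η = volume.withDensity (exponentialPDF η) := rfl
  rw [he, lintegral_withDensity_eq_lintegral_mul _ hm (by fun_prop),
    lintegral_withDensity_eq_lintegral_mul _ hm hf,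
    ← lintegral_const_mul _ (hm.mul hf)]
  rw [← lintegral_add_right_eq_self (fun y => ENNReal.ofReal (Real.exp (η * b)) *
    (exponentialPDF η * f) y) b]
  refine lintegral_mono fun y => ?_
  simp only [Pi.mul_apply]
  rw [← mul_assoc]
  gcongr
  rcases lt_or_ge y 0 with hy | hy
  · rw [exponentialPDF_of_neg hy]; exact zero_le
  · rw [exponentialPDF_of_nonneg hy, exponentialPDF_of_nonneg (by linarith),
      ← ENNReal.ofReal_mul (Real.exp_nonneg _)]
    refine ENNReal.ofReal_le_ofReal (le_of_eq ?_)
    rw [mul_left_comm, ← Real.exp_add]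
    ring_nf

lemma fpl_shift_pi {ι : Type} [Fintype ι] [DecidableEq ι] (η : ℝ) (hη : 0 < η) (i : ι)
    (b : (ι → ℝ) → ℝ) (hbm : Measurable b) (hbi : ∀ x y, b (Function.update x i y) = b x)
    (c : ℝ) (hb : ∀ x, 0 ≤ b x ∧ b x ≤ c) (F : (ι → ℝ) → ℝ≥0∞) (hF : Measurable F) :
    ∫⁻ x, F (Function.update x i (x i + b x)) ∂(Measure.pi fun _ => expMeasure η) ≤
      ENNReal.ofReal (Real.exp (η * c)) * ∫⁻ x, F x ∂(Measure.pi fun _ => expMeasure η) := by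
  haveI := isProbabilityMeasure_expMeasure hη
  have hm : Measurable fun x : ι → ℝ => Function.update x i (x i + b x) := by
    refine measurable_pi_lambda _ fun j => ?_
    by_cases hj : j = i
    · subst hj; simp only [Function.update_self]; fun_prop
    · simp only [Function.update_of_ne hj]; fun_prop
  rw [← lintegral_const_mul _ hF]
  refine lintegral_le_of_lmarginal_le {i} (hF.comp hm) (hF.const_mul _) fun x => ?_
  rw [lmarginal_singleton, lmarginal_singleton]
  simp only [Function.comp, Function.update_self, Function.update_idem, hbi]
  have hu : Measurable fun y => F (Function.update x i y) := hF.comp (measurable_update x)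
  rw [lintegral_const_mul _ hu]
  refine (fpl_shift η hη (b x) (hb x).1 (fun y => F (Function.update x i y)) hu).trans ?_
  gcongr
  exact (hb x).2

lemma fpl_meas_optVal [Nonempty A] {X : Type} [MeasurableSpace X] (p : S → A → S → ℝ)
    (R : X → S → A → ℕ → ℝ) (hR : ∀ s a h, Measurable fun x => R x s a h) (n h : ℕ) (s : S) :
    Measurable fun x => optVal p (R x) n h s := by
  induction n generalizing h s with
  | zero => simp only [optVal]; exact measurable_const
  | succ n ih =>
    simp only [optVal]
    refine Measurable.iSup fun a => (hR s a h).add ?_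
    exact Finset.measurable_sum _ fun s' _ => (ih (h + 1) s').const_mul _

lemma fpl_meas_Q [Nonempty A] {X : Type} [MeasurableSpace X] (p : S → A → S → ℝ)
    (R : X → S → A → ℕ → ℝ) (hR : ∀ s a h, Measurable fun x => R x s a h) (n h : ℕ) (s : S)
    (a : A) : Measurable fun x => fplQ p (R x) n h s a := by
  unfold fplQ
  exact (hR s a h).add
    (Finset.measurable_sum _ fun s' _ => (fpl_meas_optVal p R hR n (h + 1) s').const_mul _)

lemma fpl_meas_B [Nonempty A] {X : Type} [MeasurableSpace X] (p : S → A → S → ℝ)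
    (R : X → S → A → ℕ → ℝ) (hR : ∀ s a h, Measurable fun x => R x s a h)
    (q : S → A → ℕ → ℝ) (σ : ℕ → S) (α : ℕ → A) (k : ℕ) (ε : ℝ) (n h : ℕ)
    (hU : ∀ s, Measurable fun x => fplU p (R x) q σ α k ε n (h + 1) s) :
    Measurable fun x => fplB p (R x) q σ α k ε n h := by
  unfold fplB
  split_ifs
  · refine Measurable.add_const (Measurable.const_add ?_ _) _
    refine Finset.measurable_sum _ fun s' _ => Measurable.const_mul (Measurable.sub ?_ (hU s')) _
    exact fpl_meas_optVal p (fun x s a h => R x s a h + q s a h)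
      (fun s a h => (hR s a h).add_const _) n (h + 1) s'
  · exact measurable_const

lemma fpl_meas_U [Nonempty A] {X : Type} [MeasurableSpace X] (p : S → A → S → ℝ)
    (R : X → S → A → ℕ → ℝ) (hR : ∀ s a h, Measurable fun x => R x s a h)
    (q : S → A → ℕ → ℝ) (σ : ℕ → S) (α : ℕ → A) (k : ℕ) (ε : ℝ) (n h : ℕ) (s : S) :
    Measurable fun x => fplU p (R x) q σ α k ε n h s := by
  induction n generalizing h s with
  | zero => simp only [fplU]; exact measurable_const
  | succ n ih =>
    simp only [fplU_succ]
    refine Measurable.iSup fun a => Measurable.add (Measurable.add (hR s a h) ?_) ?_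
    · split_ifs
      · exact fpl_meas_B p R hR q σ α k ε n h fun s => ih (h + 1) s
      · exact measurable_const
    · exact Finset.measurable_sum _ fun s' _ => (ih (h + 1) s').const_mul _

/-- The reward function associated with a finite perturbation vector. -/
noncomputable def fplR (H : ℕ) (rb : S → A → ℕ → ℝ) (x : S × A × Fin H → ℝ) :
    S → A → ℕ → ℝ := fun s a h =>
  (if hh : 1 ≤ h ∧ h ≤ H then x (s, a, ⟨h - 1, by omega⟩) else 0) + rb s a h

lemma fplR_meas (H : ℕ) (rb : S → A → ℕ → ℝ) (s : S) (a : A) (h : ℕ) :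
    Measurable fun x => fplR H rb x s a h := by
  unfold fplR
  split_ifs
  · exact (measurable_pi_apply _).add_const _
  · exact measurable_const

/-- The bump map, for layers `≥ m`. -/
noncomputable def fplPhi [Nonempty A] (H : ℕ) (rb : S → A → ℕ → ℝ) (p : S → A → S → ℝ)
    (q : S → A → ℕ → ℝ) (σ : ℕ → S) (α : ℕ → A) (k : ℕ) (ε : ℝ) (m : ℕ)
    (x : S × A × Fin H → ℝ) : S × A × Fin H → ℝ := fun i =>
  x i + if m ≤ i.2.2.val + 1 ∧ i.1 = σ (i.2.2.val + 1) ∧ i.2.1 = α (i.2.2.val + 1) then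
    fplB p (fplR H rb x) q σ α k ε (H - (i.2.2.val + 1)) (i.2.2.val + 1) else 0

lemma fplPhi_meas [Nonempty A] (H : ℕ) (rb : S → A → ℕ → ℝ) (p : S → A → S → ℝ)
    (q : S → A → ℕ → ℝ) (σ : ℕ → S) (α : ℕ → A) (k : ℕ) (ε : ℝ) (m : ℕ) :
    Measurable (fplPhi H rb p q σ α k ε m) := by
  refine measurable_pi_lambda _ fun i => ?_
  unfold fplPhi
  refine (measurable_pi_apply _).add ?_
  split_ifs
  · exact fpl_meas_B p _ (fplR_meas H rb) q σ α k ε _ _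
      fun s => fpl_meas_U p _ (fplR_meas H rb) q σ α k ε _ _ s
  · exact measurable_const

lemma fplB_update [Nonempty A] (H : ℕ) (rb : S → A → ℕ → ℝ) (p : S → A → S → ℝ)
    (q : S → A → ℕ → ℝ) (σ : ℕ → S) (α : ℕ → A) (k : ℕ) (ε : ℝ) (n h : ℕ)
    (x : S × A × Fin H → ℝ) (i : S × A × Fin H) (hi : i.2.2.val + 1 ≤ h) (y : ℝ) :
    fplB p (fplR H rb (Function.update x i y)) q σ α k ε n h =
      fplB p (fplR H rb x) q σ α k ε n h := by
  refine fplB_congr _ _ _ _ _ _ _ _ _ _ fun s a j hj => ?_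
  unfold fplR
  split_ifs with hh
  · rw [Function.update_of_ne]
    intro e
    rw [← e] at hi
    simp only at hi
    omega
  · rfl

lemma fplPhi_step [Nonempty A] (H : ℕ) (rb : S → A → ℕ → ℝ) (p : S → A → S → ℝ)
    (q : S → A → ℕ → ℝ) (σ : ℕ → S) (α : ℕ → A) (k : ℕ) (ε : ℝ) (m : ℕ) (hm : m < H)
    (x : S × A × Fin H → ℝ) :
    fplPhi H rb p q σ α k ε (m + 1) x = fplPhi H rb p q σ α k ε (m + 2)
      (Function.update x (σ (m + 1), α (m + 1), ⟨m, hm⟩)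
        (x (σ (m + 1), α (m + 1), ⟨m, hm⟩) +
          fplB p (fplR H rb x) q σ α k ε (H - (m + 1)) (m + 1))) := by
  funext i
  obtain ⟨s, a, j, hj⟩ := i
  unfold fplPhi
  dsimp only
  by_cases hc : (s, a, (⟨j, hj⟩ : Fin H)) = (σ (m + 1), α (m + 1), ⟨m, hm⟩)
  · simp only [Prod.mk.injEq, Fin.mk.injEq] at hc
    obtain ⟨rfl, rfl, rfl⟩ := hc
    rw [Function.update_self]
    simp
  · rw [Function.update_of_ne hc]
    congr 1
    by_cases hjm : m + 2 ≤ j + 1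
    · rw [fplB_update _ _ _ _ _ _ _ _ _ _ _ _ (by simp only; omega)]
      simp only [hjm, show m + 1 ≤ j + 1 by omega]
    · rw [if_neg, if_neg]
      · tauto
      · rintro ⟨h1, h2, h3⟩
        apply hc
        have : j = m := by omega
        subst this
        rw [h2, h3]

lemma fpl_change [Nonempty A] (H : ℕ) (rb : S → A → ℕ → ℝ) (p : S → A → S → ℝ)
    (hp : IsKernel p) (q : S → A → ℕ → ℝ) (hq : ∀ s a h, 0 ≤ q s a h ∧ q s a h ≤ 1)
    (σ : ℕ → S) (α : ℕ → A) (k : ℕ) (ε : ℝ) (hε : 0 < ε) (η : ℝ) (hη : 0 < η)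
    (F : (S × A × Fin H → ℝ) → ℝ≥0∞) (hF : Measurable F) (d m : ℕ) (hd : m + d = H) :
    ∫⁻ x, F (fplPhi H rb p q σ α k ε (m + 1) x) ∂(Measure.pi fun _ => expMeasure η) ≤
      ENNReal.ofReal (Real.exp (η * (H * (1 + ε)))) ^ d *
        ∫⁻ x, F x ∂(Measure.pi fun _ => expMeasure η) := by
  induction d generalizing m with
  | zero =>
    have : ∀ x, fplPhi H rb p q σ α k ε (m + 1) x = x := by
      intro x
      funext i
      unfold fplPhi
      rw [if_neg, add_zero]
      have := i.2.2.isLt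
      omega
    simp [this]
  | succ d ih =>
    have hm : m < H := by omega
    simp only [fplPhi_step H rb p q σ α k ε m hm]
    refine (fpl_shift_pi η hη (σ (m + 1), α (m + 1), ⟨m, hm⟩)
      (fun x => fplB p (fplR H rb x) q σ α k ε (H - (m + 1)) (m + 1)) ?_ ?_ (H * (1 + ε)) ?_
      (fun x => F (fplPhi H rb p q σ α k ε (m + 2) x)) ?_).trans ?_
    · exact fpl_meas_B p _ (fplR_meas H rb) q σ α k ε _ _
        fun s => fpl_meas_U p _ (fplR_meas H rb) q σ α k ε _ _ s
    · intro x y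
      exact fplB_update _ _ _ _ _ _ _ _ _ _ _ _ le_rfl _
    · intro x
      have := fplB_bounds p hp (fplR H rb x) q hq σ α k ε hε (H - (m + 1)) (m + 1)
      refine ⟨this.1, this.2.trans ?_⟩
      gcongr
      exact_mod_cast (by omega : H - (m + 1) + 1 ≤ H)
    · exact hF.comp (fplPhi_meas ..)
    · rw [pow_succ', mul_assoc]
      gcongr
      exact ih (m + 1) (by omega)

/-- weak optimality indicator -/
noncomputable def fplCw [Nonempty A] (p : S → A → S → ℝ) (ρ : S → A → ℕ → ℝ) (H : ℕ)
    (s : S) (h : ℕ) (a : A) : ℝ≥0∞ :=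
  if ∀ b, fplQ p ρ (H - h) h s b ≤ fplQ p ρ (H - h) h s a then 1 else 0

/-- strict optimality indicator -/
noncomputable def fplCs [Nonempty A] (p : S → A → S → ℝ) (ρ : S → A → ℕ → ℝ) (H : ℕ)
    (s : S) (h : ℕ) (a : A) : ℝ≥0∞ :=
  if ∀ b, b ≠ a → fplQ p ρ (H - h) h s b < fplQ p ρ (H - h) h s a then 1 else 0

lemma fplCw_meas [Nonempty A] {X : Type} [MeasurableSpace X] (p : S → A → S → ℝ)
    (R : X → S → A → ℕ → ℝ) (hR : ∀ s a h, Measurable fun x => R x s a h) (H : ℕ)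
    (s : S) (h : ℕ) (a : A) : Measurable fun x => fplCw p (R x) H s h a := by
  unfold fplCw
  refine Measurable.ite ?_ measurable_const measurable_const
  rw [Set.ofPred_forall]
  exact MeasurableSet.iInter fun b => measurableSet_le (fpl_meas_Q p R hR _ _ _ _)
    (fpl_meas_Q p R hR _ _ _ _)

lemma fplCs_meas [Nonempty A] {X : Type} [MeasurableSpace X] (p : S → A → S → ℝ)
    (R : X → S → A → ℕ → ℝ) (hR : ∀ s a h, Measurable fun x => R x s a h) (H : ℕ)
    (s : S) (h : ℕ) (a : A) : Measurable fun x => fplCs p (R x) H s h a := by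
  unfold fplCs
  refine Measurable.ite ?_ measurable_const measurable_const
  simp only [Set.ofPred_forall]
  exact MeasurableSet.iInter fun b => MeasurableSet.iInter fun _ =>
    measurableSet_lt (fpl_meas_Q p R hR _ _ _ _) (fpl_meas_Q p R hR _ _ _ _)

/-- The comparison of trajectory probabilities. -/
lemma fpl_traj [Nonempty A] (H : ℕ) (rb : S → A → ℕ → ℝ) (p : S → A → S → ℝ)
    (hp : IsKernel p) (q : S → A → ℕ → ℝ) (hq : ∀ s a h, 0 ≤ q s a h ∧ q s a h ≤ 1)
    (σ : ℕ → S) (α : ℕ → A) (k : ℕ) (hk : k ≤ H + 1) (ε : ℝ) (hε : 0 < ε) (η : ℝ) (hη : 0 < η) :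
    ∫⁻ x, ∏ j ∈ Finset.Ico 1 k,
        fplCw p (fun s a h => fplR H rb x s a h + q s a h) H (σ j) j (α j)
        ∂(Measure.pi fun _ => expMeasure η) ≤
      ENNReal.ofReal (Real.exp (η * (H * (1 + ε)))) ^ H *
        ∫⁻ x, ∏ j ∈ Finset.Ico 1 k, fplCs p (fplR H rb x) H (σ j) j (α j)
          ∂(Measure.pi fun _ => expMeasure η) := by
  refine le_trans ?_ (fpl_change H rb p hp q hq σ α k ε hε η hη
    (fun x => ∏ j ∈ Finset.Ico 1 k, fplCs p (fplR H rb x) H (σ j) j (α j))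
    (Finset.measurable_prod _ fun j _ => fplCs_meas p _ (fplR_meas H rb) H _ _ _) H 0 (by omega))
  refine lintegral_mono fun x => ?_
  refine Finset.prod_le_prod' fun j hj => ?_
  rw [Finset.mem_Ico] at hj
  unfold fplCw fplCs
  split_ifs with h1 h2
  · exact le_rfl
  · refine absurd ?_ h2
    refine fpl_strict p hp (fplR H rb x) _ q hq σ α k ε hε H ?_ j hj.1 (by omega) hj.2 h1
    intro s a h h1 h2
    unfold fplR fplPhi
    simp only [h1, h2, and_self, dite_true]
    rw [show h - 1 + 1 = h by omega]
    simp only [show 0 + 1 ≤ h by omega, true_and]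
    unfold fplR
    ring
  · exact zero_le
  · exact le_rfl

/-- value of a stochastic choice of weights -/
noncomputable def fplG (p : S → A → S → ℝ) (q : S → A → ℕ → ℝ)
    (c : S → ℕ → A → ℝ≥0∞) : ℕ → ℕ → S → ℝ≥0∞
  | 0, _, _ => 0
  | n + 1, h, s => ∑ a : A, c s h a * (ENNReal.ofReal (q s a h) +
      ∑ s' : S, ENNReal.ofReal (p s a s') * fplG p q c n (h + 1) s')

lemma fplG_meas {X : Type} [MeasurableSpace X] (p : S → A → S → ℝ) (q : S → A → ℕ → ℝ)
    (c : X → S → ℕ → A → ℝ≥0∞) (hc : ∀ s h a, Measurable fun x => c x s h a) (n h : ℕ) (s : S) :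
    Measurable fun x => fplG p q (c x) n h s := by
  induction n generalizing h s with
  | zero => simp only [fplG]; exact measurable_const
  | succ n ih =>
    simp only [fplG]
    exact Finset.measurable_sum _ fun a _ => (hc s h a).mul (Measurable.const_add
      (Finset.measurable_sum _ fun s' _ => (ih (h + 1) s').const_mul _) _)

lemma fplG_expand {X : Type} [MeasurableSpace X] (μ : Measure X)
    (p : S → A → S → ℝ) (q : S → A → ℕ → ℝ)
    (c : X → S → ℕ → A → ℝ≥0∞) (hc : ∀ s h a, Measurable fun x => c x s h a)
    (n h : ℕ) (h1 : 1 ≤ h) (s : S) (σ : ℕ → S) (α : ℕ → A) :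
    ∫⁻ x, (∏ j ∈ Finset.Ico 1 h, c x (σ j) j (α j)) * fplG p q (c x) (n + 1) h s ∂μ =
    ∑ a, (ENNReal.ofReal (q s a h) * ∫⁻ x, ∏ j ∈ Finset.Ico 1 (h + 1),
        c x (Function.update σ h s j) j (Function.update α h a j) ∂μ +
      ∑ s', ENNReal.ofReal (p s a s') * ∫⁻ x, (∏ j ∈ Finset.Ico 1 (h + 1),
        c x (Function.update σ h s j) j (Function.update α h a j)) *
          fplG p q (c x) n (h + 1) s' ∂μ) := by
  have hP : ∀ (σ : ℕ → S) (α : ℕ → A) (k : ℕ), Measurable fun x => ∏ j ∈ Finset.Ico 1 k, c x (σ j) j (α j) :=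
    fun σ α k => Finset.measurable_prod _ fun j _ => hc _ _ _
  have hG : ∀ s', Measurable fun x => fplG p q (c x) n (h + 1) s' :=
    fun s' => fplG_meas p q c hc n (h + 1) s'
  have e : ∀ a x, ∏ j ∈ Finset.Ico 1 (h + 1),
      c x (Function.update σ h s j) j (Function.update α h a j) =
      (∏ j ∈ Finset.Ico 1 h, c x (σ j) j (α j)) * c x s h a := by
    intro a x
    rw [Finset.prod_Ico_succ_top h1]
    simp only [Function.update_self]
    congr 1
    refine Finset.prod_congr rfl fun j hj => ?_
    rw [Finset.mem_Ico] at hj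
    rw [Function.update_of_ne (by omega), Function.update_of_ne (by omega)]
  have hPG : ∀ a s', Measurable fun x => (∏ j ∈ Finset.Ico 1 (h + 1),
        c x (Function.update σ h s j) j (Function.update α h a j)) *
          fplG p q (c x) n (h + 1) s' := fun a s' => (hP _ _ _).mul (hG s')
  have e2 : ∀ a, (ENNReal.ofReal (q s a h) * ∫⁻ x, ∏ j ∈ Finset.Ico 1 (h + 1),
        c x (Function.update σ h s j) j (Function.update α h a j) ∂μ +
      ∑ s', ENNReal.ofReal (p s a s') * ∫⁻ x, (∏ j ∈ Finset.Ico 1 (h + 1),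
        c x (Function.update σ h s j) j (Function.update α h a j)) *
          fplG p q (c x) n (h + 1) s' ∂μ) =
      ∫⁻ x, (ENNReal.ofReal (q s a h) * ∏ j ∈ Finset.Ico 1 (h + 1),
        c x (Function.update σ h s j) j (Function.update α h a j) +
      ∑ s', ENNReal.ofReal (p s a s') * ((∏ j ∈ Finset.Ico 1 (h + 1),
        c x (Function.update σ h s j) j (Function.update α h a j)) *
          fplG p q (c x) n (h + 1) s')) ∂μ := by
    intro a
    rw [lintegral_add_left ((hP _ _ _).const_mul _), lintegral_const_mul _ (hP _ _ _),
      lintegral_finsetSum _ fun s' _ => (hPG a s').const_mul _]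
    congr 1
    refine Finset.sum_congr rfl fun s' _ => ?_
    rw [lintegral_const_mul _ (hPG a s')]
  simp only [e2]
  rw [← lintegral_finsetSum]
  swap
  · exact fun a _ => ((hP _ _ _).const_mul _).add
      (Finset.measurable_sum _ fun s' _ => (hPG a s').const_mul _)
  refine lintegral_congr fun x => ?_
  rw [fplG, Finset.mul_sum]
  refine Finset.sum_congr rfl fun a _ => ?_
  rw [e, mul_add, mul_add, Finset.mul_sum, Finset.mul_sum]
  congr 1
  · ring
  · refine Finset.sum_congr rfl fun s' _ => ?_
    ring

lemma fplG_compare {X : Type} [MeasurableSpace X] (μ : Measure X)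
    (p : S → A → S → ℝ) (q : S → A → ℕ → ℝ)
    (c c' : X → S → ℕ → A → ℝ≥0∞) (hc : ∀ s h a, Measurable fun x => c x s h a)
    (hc' : ∀ s h a, Measurable fun x => c' x s h a) (C : ℝ≥0∞) (H : ℕ)
    (hC : ∀ (σ : ℕ → S) (α : ℕ → A) (k : ℕ), k ≤ H + 1 → ∫⁻ x, ∏ j ∈ Finset.Ico 1 k, c x (σ j) j (α j) ∂μ ≤
      C * ∫⁻ x, ∏ j ∈ Finset.Ico 1 k, c' x (σ j) j (α j) ∂μ)
    (n h : ℕ) (h1 : 1 ≤ h) (hn : h + n = H + 1) (s : S) (σ : ℕ → S) (α : ℕ → A) :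
    ∫⁻ x, (∏ j ∈ Finset.Ico 1 h, c x (σ j) j (α j)) * fplG p q (c x) n h s ∂μ ≤
    C * ∫⁻ x, (∏ j ∈ Finset.Ico 1 h, c' x (σ j) j (α j)) * fplG p q (c' x) n h s ∂μ := by
  induction n generalizing h s σ α with
  | zero => simp [fplG]
  | succ n ih =>
    rw [fplG_expand μ p q c hc n h h1, fplG_expand μ p q c' hc' n h h1, Finset.mul_sum]
    refine Finset.sum_le_sum fun a _ => ?_
    rw [mul_add, Finset.mul_sum]
    refine add_le_add ?_ (Finset.sum_le_sum fun s' _ => ?_)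
    · rw [mul_left_comm]
      gcongr
      exact hC _ _ _ (by omega)
    · rw [mul_left_comm]
      gcongr
      exact ih (h + 1) (by omega) (by omega) s' _ _

lemma fpl_polVal_nonneg (p : S → A → S → ℝ) (hp : IsKernel p) (q : S → A → ℕ → ℝ)
    (hq : ∀ s a h, 0 ≤ q s a h) (π : S → ℕ → A) (n h : ℕ) (s : S) :
    0 ≤ polVal p q π n h s := by
  induction n generalizing h s with
  | zero => simp [polVal]
  | succ n ih =>
    rw [polVal]
    exact add_nonneg (hq _ _ _) (Finset.sum_nonneg fun s' _ => mul_nonneg (hp.1 _ _ _) (ih _ _))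

lemma fpl_ofReal_polVal (p : S → A → S → ℝ) (hp : IsKernel p) (q : S → A → ℕ → ℝ)
    (hq : ∀ s a h, 0 ≤ q s a h) (π : S → ℕ → A) (n h : ℕ) (s : S) :
    ENNReal.ofReal (polVal p q π (n + 1) h s) = ENNReal.ofReal (q s (π s h) h) +
      ∑ s' : S, ENNReal.ofReal (p s (π s h) s') *
        ENNReal.ofReal (polVal p q π n (h + 1) s') := by
  have h0 := fpl_polVal_nonneg p hp q hq π n (h + 1)
  rw [polVal, ENNReal.ofReal_add (hq _ _ _)
    (Finset.sum_nonneg fun s' _ => mul_nonneg (hp.1 _ _ _) (h0 _)),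
    ENNReal.ofReal_sum_of_nonneg fun s' _ => mul_nonneg (hp.1 _ _ _) (h0 _)]
  simp only [ENNReal.ofReal_mul (hp.1 _ _ _)]

lemma fpl_polVal_le_G (p : S → A → S → ℝ) (hp : IsKernel p) (q : S → A → ℕ → ℝ)
    (hq : ∀ s a h, 0 ≤ q s a h) (π : S → ℕ → A) (c : S → ℕ → A → ℝ≥0∞) (H : ℕ)
    (hc : ∀ s h, 1 ≤ h → h ≤ H → c s h (π s h) = 1)
    (n h : ℕ) (h1 : 1 ≤ h) (hn : h + n = H + 1) (s : S) :
    ENNReal.ofReal (polVal p q π n h s) ≤ fplG p q c n h s := by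
  induction n generalizing h s with
  | zero => simp [polVal]
  | succ n ih =>
    rw [fpl_ofReal_polVal p hp q hq, fplG]
    refine le_trans ?_ (Finset.single_le_sum (fun a _ => zero_le) (Finset.mem_univ (π s h)))
    rw [hc s h h1 (by omega), one_mul]
    gcongr with s' _
    exact ih (h + 1) (by omega) (by omega) s'

lemma fpl_G_le_polVal (p : S → A → S → ℝ) (hp : IsKernel p) (q : S → A → ℕ → ℝ)
    (hq : ∀ s a h, 0 ≤ q s a h) (π : S → ℕ → A) (c : S → ℕ → A → ℝ≥0∞) (H : ℕ)
    (hc : ∀ s h a, 1 ≤ h → h ≤ H → c s h a ≤ if a = π s h then 1 else 0)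
    (n h : ℕ) (h1 : 1 ≤ h) (hn : h + n = H + 1) (s : S) :
    fplG p q c n h s ≤ ENNReal.ofReal (polVal p q π n h s) := by
  induction n generalizing h s with
  | zero => simp [fplG]
  | succ n ih =>
    rw [fpl_ofReal_polVal p hp q hq, fplG]
    calc _ ≤ ∑ a, (if a = π s h then 1 else 0) * (ENNReal.ofReal (q s a h) +
            ∑ s' : S, ENNReal.ofReal (p s a s') * ENNReal.ofReal (polVal p q π n (h + 1) s')) := by
          gcongr with a _ s' _
          · exact hc s h a h1 (by omega)
          · exact ih (h + 1) (by omega) (by omega) s'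
      _ = _ := by simp

/-- An optimal policy picks maximisers of the state-action value. -/
lemma fpl_opt_argmax [Nonempty A] (p : S → A → S → ℝ) (ρ : S → A → ℕ → ℝ) (H : ℕ)
    (π : S → ℕ → A) (hopt : IsOptimal p ρ H π) (s : S) (h : ℕ) (h1 : 1 ≤ h) (hH : h ≤ H) (b : A) :
    fplQ p ρ (H - h) h s b ≤ fplQ p ρ (H - h) h s (π s h) := by
  have e := hopt h s h1 hH
  rw [show H + 1 - h = (H - h) + 1 by omega, fpl_optVal_succ, polVal] at e
  have e2 : ∀ s', polVal p ρ π (H - h) (h + 1) s' = optVal p ρ (H - h) (h + 1) s' := by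
    intro s'
    by_cases hh : h + 1 ≤ H
    · have := hopt (h + 1) s' (by omega) hh
      rwa [show H + 1 - (h + 1) = H - h by omega] at this
    · rw [show H - h = 0 by omega]; rfl
  simp only [e2] at e
  have e3 : fplQ p ρ (H - h) h s (π s h) = ⨆ a, fplQ p ρ (H - h) h s a := e
  rw [e3]
  exact le_ciSup (fpl_bdd _) b

lemma fpl_polVal_le (p : S → A → S → ℝ) (hp : IsKernel p) (q : S → A → ℕ → ℝ)
    (hq : ∀ s a h, q s a h ≤ 1) (π : S → ℕ → A) (n h : ℕ) (s : S) :
    polVal p q π n h s ≤ n := by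
  induction n generalizing h s with
  | zero => simp [polVal]
  | succ n ih =>
    rw [polVal]
    have h1 := fpl_avg p hp s (π s h) (polVal p q π n (h + 1)) (fun _ => 0) n
      fun s' => by simpa using ih (h + 1) s'
    simp only [mul_zero, Finset.sum_const_zero, zero_add] at h1
    have := hq s (π s h) h
    push_cast
    linarith

lemma fpl_main_aux [Nonempty A]
    {Ω : Type} [MeasurableSpace Ω] (P : Measure Ω) [IsProbabilityMeasure P]
    (H : ℕ) (p : S → A → S → ℝ) (hp : IsKernel p)
    (η : ℝ) (hη : 0 < η)
    (rb q : S → A → ℕ → ℝ) (hq : ∀ s a h, 0 ≤ q s a h ∧ q s a h ≤ 1)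
    (R0 : Ω → S → A → ℕ → ℝ)
    (hR0dist : ∀ s a h, 1 ≤ h → h ≤ H →
      Measure.map (fun ω => R0 ω s a h) P = expMeasure η)
    (hR0indep : iIndepFun
      (fun (x : S × A × Fin H) ω => R0 ω x.1 x.2.1 (x.2.2.val + 1)) P)
    (π π' : Ω → S → ℕ → A)
    (hπ : ∀ ω, IsOptimal p (fun s a h => R0 ω s a h + rb s a h) H (π ω))
    (hπ' : ∀ ω, IsOptimal p (fun s a h => R0 ω s a h + rb s a h + q s a h) H (π' ω))
    (s : S) (ε : ℝ) (hε : 0 < ε) :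
    ∫⁻ ω, ENNReal.ofReal (polVal p q (π' ω) H 1 s) ∂P ≤
      ENNReal.ofReal (Real.exp (η * (H * (1 + ε)))) ^ H *
        ∫⁻ ω, ENNReal.ofReal (polVal p q (π ω) H 1 s) ∂P := by
  have hprob := isProbabilityMeasure_expMeasure hη
  let X : Ω → (S × A × Fin H → ℝ) := fun ω x => R0 ω x.1 x.2.1 (x.2.2.val + 1)
  have hXi : ∀ i : S × A × Fin H,
      Measure.map (fun ω => R0 ω i.1 i.2.1 (i.2.2.val + 1)) P = expMeasure η := fun i =>
    hR0dist _ _ _ (by omega) (by have := i.2.2.isLt; omega)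
  have hXm : ∀ i : S × A × Fin H, AEMeasurable (fun ω => R0 ω i.1 i.2.1 (i.2.2.val + 1)) P := by
    intro i
    refine AEMeasurable.of_map_ne_zero ?_
    rw [hXi i]
    exact IsProbabilityMeasure.ne_zero _
  have hX : AEMeasurable X P := aemeasurable_pi_lambda _ hXm
  have hmap : Measure.map X P = Measure.pi fun _ => expMeasure η := by
    have := (iIndepFun_iff_map_fun_eq_pi_map hXm).1 hR0indep
    simp only [hXi] at this
    exact this
  have hagree : ∀ ω s a h, 1 ≤ h → h ≤ H →
      R0 ω s a h + rb s a h = fplR H rb (X ω) s a h := by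
    intro ω s a h h1 h2
    simp only [fplR, X, h1, h2, and_self, dite_true]
    rw [show h - 1 + 1 = h by omega]
  have hq0 : ∀ s a h, 0 ≤ q s a h := fun s a h => (hq s a h).1
  have hmR : ∀ s a h, Measurable fun x => fplR H rb x s a h + q s a h :=
    fun s a h => (fplR_meas H rb s a h).add_const _
  have hmw := fplG_meas p q (fun x => fplCw p (fun s a h => fplR H rb x s a h + q s a h) H)
    (fun s h a => fplCw_meas p _ hmR H s h a) H 1 s
  have hms := fplG_meas p q (fun x => fplCs p (fplR H rb x) H)
    (fun s h a => fplCs_meas p _ (fplR_meas H rb) H s h a) H 1 s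
  calc ∫⁻ ω, ENNReal.ofReal (polVal p q (π' ω) H 1 s) ∂P
      ≤ ∫⁻ ω, fplG p q (fplCw p (fun s a h => fplR H rb (X ω) s a h + q s a h) H) H 1 s ∂P := by
        refine lintegral_mono fun ω => ?_
        refine fpl_polVal_le_G p hp q hq0 _ _ H ?_ H 1 le_rfl (by omega) s
        intro s h h1 h2
        unfold fplCw
        rw [if_pos]
        intro b
        have key := fpl_opt_argmax p _ H _ (hπ' ω) s h h1 h2 b
        have e : ∀ b, fplQ p (fun s a h => fplR H rb (X ω) s a h + q s a h) (H - h) h s b =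
            fplQ p (fun s a h => R0 ω s a h + rb s a h + q s a h) (H - h) h s b := fun b =>
          fplQ_congr p _ _ _ _ _ _ fun s a j hj1 hj2 => by
            rw [hagree ω s a j (by omega) (by omega)]
        rw [e, e]
        exact key
    _ = ∫⁻ x, fplG p q (fplCw p (fun s a h => fplR H rb x s a h + q s a h) H) H 1 s
          ∂(Measure.pi fun _ => expMeasure η) := by
        rw [← hmap, lintegral_map' hmw.aemeasurable hX]
    _ ≤ ENNReal.ofReal (Real.exp (η * (H * (1 + ε)))) ^ H *
        ∫⁻ x, fplG p q (fplCs p (fplR H rb x) H) H 1 s ∂(Measure.pi fun _ => expMeasure η) := by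
        have := fplG_compare (Measure.pi fun _ => expMeasure η) p q
          (fun x => fplCw p (fun s a h => fplR H rb x s a h + q s a h) H)
          (fun x => fplCs p (fplR H rb x) H)
          (fun s h a => fplCw_meas p _ hmR H s h a)
          (fun s h a => fplCs_meas p _ (fplR_meas H rb) H s h a) _ H
          (fun σ α k hk => fpl_traj H rb p hp q hq σ α k hk ε hε η hη)
          H 1 le_rfl (by omega) s (fun _ => s) (fun _ => Classical.arbitrary A)
        simpa using this
    _ = ENNReal.ofReal (Real.exp (η * (H * (1 + ε)))) ^ H *
        ∫⁻ ω, fplG p q (fplCs p (fplR H rb (X ω)) H) H 1 s ∂P := by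
        rw [← hmap, lintegral_map' hms.aemeasurable hX]
    _ ≤ _ := by
        gcongr with ω
        refine fpl_G_le_polVal p hp q hq0 _ _ H ?_ H 1 le_rfl (by omega) s
        intro s h a h1 h2
        by_cases ha : a = π ω s h
        · rw [if_pos ha]
          unfold fplCs
          split_ifs
          · exact le_rfl
          · exact zero_le
        · unfold fplCs
          rw [if_neg]
          · exact zero_le
          · intro hall
            have key := fpl_opt_argmax p _ H _ (hπ ω) s h h1 h2 a
            have e : ∀ b, fplQ p (fplR H rb (X ω)) (H - h) h s b =
                fplQ p (fun s a h => R0 ω s a h + rb s a h) (H - h) h s b := fun b =>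
              fplQ_congr p _ _ _ _ _ _ fun s a j hj1 hj2 => by
                rw [hagree ω s a j (by omega) (by omega)]
            have h3 := hall _ (Ne.symm ha)
            rw [e, e] at h3
            exact absurd key (not_le.2 h3)

end FPLaux


/-- Under the FPL algorithm with any parameter `η > 0`, for every episode
`t ∈ {1,…,T}` and every state `s`,
`E[V^{π_{t+1}}(s, r_t)] ≤ e^{η H²} · E[V^{π_t}(s, r_t)]`,
where the expectation is over the random perturbation `r₀`. -/
theorem fpl_stability_of_values
    {S A : Type} [Fintype S] [Fintype A] [Nonempty S] [Nonempty A]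
    {Ω : Type} [MeasurableSpace Ω] (P : Measure Ω) [IsProbabilityMeasure P]
    (H T : ℕ) (hH : 0 < H) (hT : 0 < T) (s₁ : S)
    (p : S → A → S → ℝ) (hp : IsKernel p)
    (η : ℝ) (hη : 0 < η)
    (r : ℕ → S → A → ℕ → ℝ) (hr : ∀ t s a h, 0 ≤ r t s a h ∧ r t s a h ≤ 1)
    (R0 : Ω → S → A → ℕ → ℝ)
    (hR0dist : ∀ s a h, 1 ≤ h → h ≤ H →
      Measure.map (fun ω => R0 ω s a h) P = expMeasure η)
    (hR0indep : iIndepFun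
      (fun (x : S × A × Fin H) ω => R0 ω x.1 x.2.1 (x.2.2.val + 1)) P)
    (π : ℕ → Ω → S → ℕ → A)
    (hπopt : ∀ t ω, IsOptimal p
      (fun s a h => R0 ω s a h + ∑ τ ∈ Finset.Icc 1 (t - 1), r τ s a h) H (π t ω))
    (hπmeas : ∀ t s, Measurable fun ω => polVal p (r t) (π t ω) H 1 s) :
    ∀ t s, 1 ≤ t → t ≤ T →
      ∫ ω, polVal p (r t) (π (t + 1) ω) H 1 s ∂P
        ≤ Real.exp (η * H ^ 2) * ∫ ω, polVal p (r t) (π t ω) H 1 s ∂P := by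
  intro t s ht1 htT
  set f := fun ω => polVal p (r t) (π t ω) H 1 s with hf
  set g := fun ω => polVal p (r t) (π (t + 1) ω) H 1 s with hg
  have hf0 : ∀ ω, 0 ≤ f ω := fun ω =>
    fpl_polVal_nonneg p hp (r t) (fun s a h => (hr t s a h).1) _ _ _ _
  have hg0 : ∀ ω, 0 ≤ g ω := fun ω =>
    fpl_polVal_nonneg p hp (r t) (fun s a h => (hr t s a h).1) _ _ _ _
  have hfm : Measurable f := hπmeas t s
  have hfint : ∫ ω, f ω ∂P = (∫⁻ ω, ENNReal.ofReal (f ω) ∂P).toReal :=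
    integral_eq_lintegral_of_nonneg_ae (Filter.Eventually.of_forall hf0)
      hfm.aestronglyMeasurable
  have hffin : ∫⁻ ω, ENNReal.ofReal (f ω) ∂P ≠ ⊤ := by
    refine ne_top_of_le_ne_top (ENNReal.ofReal_ne_top (r := (H : ℝ))) ?_
    calc ∫⁻ ω, ENNReal.ofReal (f ω) ∂P ≤ ∫⁻ _, ENNReal.ofReal (H : ℝ) ∂P :=
          lintegral_mono fun ω => ENNReal.ofReal_le_ofReal
            (fpl_polVal_le p hp (r t) (fun s a h => (hr t s a h).2) _ _ _ _)
      _ = ENNReal.ofReal (H : ℝ) := by simp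
  have hgint : ∫ ω, g ω ∂P ≤ (∫⁻ ω, ENNReal.ofReal (g ω) ∂P).toReal := by
    by_cases hm : AEStronglyMeasurable g P
    · exact (integral_eq_lintegral_of_nonneg_ae (Filter.Eventually.of_forall hg0) hm).le
    · rw [integral_non_aestronglyMeasurable hm]
      exact ENNReal.toReal_nonneg
  have key : ∀ ε : ℝ, 0 < ε →
      ∫ ω, g ω ∂P ≤ Real.exp (η * (H * (1 + ε))) ^ H * ∫ ω, f ω ∂P := by
    intro ε hε
    have h1 := fpl_main_aux P H p hp η hη
      (fun s a h => ∑ τ ∈ Finset.Icc 1 (t - 1), r τ s a h) (r t) (hr t) R0 hR0dist hR0indep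
      (π t) (π (t + 1)) (hπopt t) (by
        intro ω
        have h2 := hπopt (t + 1) ω
        have e : (fun s a h => R0 ω s a h + ∑ τ ∈ Finset.Icc 1 (t + 1 - 1), r τ s a h) =
            (fun s a h => R0 ω s a h + (∑ τ ∈ Finset.Icc 1 (t - 1), r τ s a h) + r t s a h) := by
          funext s a h
          obtain ⟨u, rfl⟩ : ∃ u, t = u + 1 := ⟨t - 1, by omega⟩
          simp only [Nat.add_sub_cancel]
          rw [Finset.sum_Icc_succ_top (by omega)]
          ring
        rw [e] at h2
        exact h2) s ε hε
    refine hgint.trans ?_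
    rw [hfint]
    have h2 := ENNReal.toReal_mono
      (ENNReal.mul_ne_top (ENNReal.pow_ne_top ENNReal.ofReal_ne_top) hffin) h1
    rw [ENNReal.toReal_mul, ENNReal.toReal_pow, ENNReal.toReal_ofReal (Real.exp_nonneg _)] at h2
    exact h2
  have hcont : Continuous fun ε : ℝ => Real.exp (η * (H * (1 + ε))) ^ H * ∫ ω, f ω ∂P := by
    fun_prop
  have hlim := (hcont.tendsto 0).mono_left (nhdsWithin_le_nhds (s := Set.Ioi (0 : ℝ)))
  have hfinal := ge_of_tendsto hlim (by
    filter_upwards [self_mem_nhdsWithin] with ε hε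
    exact key ε hε)
  have e : Real.exp (η * (H * (1 + 0))) ^ H = Real.exp (η * H ^ 2) := by
    rw [← Real.exp_nat_mul]
    ring_nf
  rw [e] at hfinal
  exact hfinal
end
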